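/- For any planar hypermap M and ring of faces l in M of length n, breaking the links of the ring one at a time yields a sequence of hypermaps M = M₀, M₁, ..., Mₙ such that M₁, ..., M_{n-1} have the same number of components as M, and only the final break disconnects: nc(Mₙ) = nc(M) + 1. -/

import Mathlib

open scoped Classical

/-- Dimensions 0 and 1. -/
inductive Dim : Type
  | zero : Dim
  | one : Dim
deriving DecidableEq

/-- Free maps: empty map, dart insertion, dart linking at a dimension. -/
inductive Fmap : Type
  | V : Fmap
  | I : Fmap → Nat → Fmap
  | L : Fmap → Dim → Nat → Nat → Fmap

namespace Fmap

/-- The nil (exception) dart. -/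
def nil : Nat := 0

/-- A dart exists in the map. -/
def exd : Fmap → Nat → Prop
  | V, _ => False
  | I m0 x, z => z = x ∨ exd m0 z
  | L m0 _ _ _, z => exd m0 z

/-- The (partial) k-successor α_k, with nil for undefined. -/
def A : Fmap → Dim → Nat → Nat
  | V, _, _ => nil
  | I m0 _, k, z => A m0 k z
  | L m0 k0 x y, k, z =>
      if k = k0 then (if z = x then y else A m0 k z) else A m0 k z

/-- The (partial) k-predecessor. -/
def A_1 : Fmap → Dim → Nat → Nat
  | V, _, _ => nil
  | I m0 _, k, z => A_1 m0 k z
  | L m0 k0 x y, k, z =>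
      if k = k0 then (if z = y then x else A_1 m0 k z) else A_1 m0 k z

/-- z has a k-successor. -/
def succd (m : Fmap) (k : Dim) (z : Nat) : Prop := A m k z ≠ nil

/-- z has a k-predecessor. -/
def predd (m : Fmap) (k : Dim) (z : Nat) : Prop := A_1 m k z ≠ nil

/-- Bottom dart of the open k-orbit of z. -/
def bottom : Fmap → Dim → Nat → Nat
  | V, _, _ => nil
  | I m0 x, k, z => if z = x then z else bottom m0 k z
  | L m0 k0 x y, k, z =>
      if k = k0 then
        (if bottom m0 k z = y then bottom m0 k x else bottom m0 k z)
      else bottom m0 k z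

/-- Top dart of the open k-orbit of z. -/
def top : Fmap → Dim → Nat → Nat
  | V, _, _ => nil
  | I m0 x, k, z => if z = x then z else top m0 k z
  | L m0 k0 x y, k, z =>
      if k = k0 then
        (if top m0 k z = x then top m0 k y else top m0 k z)
      else top m0 k z

/-- Closure of A: a permutation of existing darts. -/
def cA : Fmap → Dim → Nat → Nat
  | V, _, _ => nil
  | I m0 x, k, z => if z = x then z else cA m0 k z
  | L m0 k0 x y, k, z =>
      if k = k0 then
        (if z = x then y
         else if z = top m0 k y then bottom m0 k x
         else cA m0 k z)
      else cA m0 k z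

/-- Closure of A_1: the inverse permutation of cA. -/
def cA_1 : Fmap → Dim → Nat → Nat
  | V, _, _ => nil
  | I m0 x, k, z => if z = x then z else cA_1 m0 k z
  | L m0 k0 x y, k, z =>
      if k = k0 then
        (if z = y then x
         else if z = bottom m0 k x then top m0 k y
         else cA_1 m0 k z)
      else cA_1 m0 k z

/-- Precondition for inserting a dart. -/
def prec_I (m : Fmap) (x : Nat) : Prop := x ≠ nil ∧ ¬ exd m x

/-- Precondition for linking two darts at a dimension (keeping orbits open). -/
def prec_L (m : Fmap) (k : Dim) (x y : Nat) : Prop :=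
  exd m x ∧ exd m y ∧ ¬ succd m k x ∧ ¬ predd m k y ∧ cA m k x ≠ y

/-- The hypermap invariant. -/
def inv_hmap : Fmap → Prop
  | V => True
  | I m0 x => inv_hmap m0 ∧ prec_I m0 x
  | L m0 k0 x y => inv_hmap m0 ∧ prec_L m0 k0 x y

/-- The closed face map cF, corresponding to φ = α₁⁻¹ ∘ α₀⁻¹. -/
def cF (m : Fmap) (z : Nat) : Nat := cA_1 m Dim.one (cA_1 m Dim.zero z)

/-- Two darts are in the same face (existence of a cF-path). -/
def expf (m : Fmap) (z t : Nat) : Prop := exd m z ∧ ∃ n : ℕ, (cF m)^[n] z = t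

/-- Two darts are in the same edge (existence of a (cA zero)-path). -/
def expe (m : Fmap) (z t : Nat) : Prop := exd m z ∧ ∃ n : ℕ, (fun w => cA m Dim.zero w)^[n] z = t

/-- Two darts are in the same connected component. -/
def eqc : Fmap → Nat → Nat → Prop
  | V, _, _ => False
  | I m0 x, z, t => (z = x ∧ t = x) ∨ eqc m0 z t
  | L m0 _ x y, z, t =>
      eqc m0 z t ∨ (eqc m0 z x ∧ eqc m0 y t) ∨ (eqc m0 z y ∧ eqc m0 x t)

/-- Number of darts. -/
def nd : Fmap → ℤ
  | V => 0
  | I m0 _ => nd m0 + 1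
  | L m0 _ _ _ => nd m0

/-- Number of vertices. -/
def nv : Fmap → ℤ
  | V => 0
  | I m0 _ => nv m0 + 1
  | L m0 Dim.zero _ _ => nv m0
  | L m0 Dim.one _ _ => nv m0 - 1

/-- Number of edges. -/
def ne : Fmap → ℤ
  | V => 0
  | I m0 _ => ne m0 + 1
  | L m0 Dim.zero _ _ => ne m0 - 1
  | L m0 Dim.one _ _ => ne m0

/-- Number of faces. -/
noncomputable def nf : Fmap → ℤ
  | V => 0
  | I m0 _ => nf m0 + 1
  | L m0 Dim.zero x y => if expf m0 (cA_1 m0 Dim.one x) y then nf m0 + 1 else nf m0 - 1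
  | L m0 Dim.one x y => if expf m0 x (cA m0 Dim.zero y) then nf m0 + 1 else nf m0 - 1

/-- Number of connected components. -/
noncomputable def nc : Fmap → ℤ
  | V => 0
  | I m0 _ => nc m0 + 1
  | L m0 _ x y => if eqc m0 x y then nc m0 else nc m0 - 1

/-- Euler characteristic. -/
noncomputable def ec (m : Fmap) : ℤ := nv m + ne m + nf m - nd m

/-- Genus. -/
noncomputable def genus (m : Fmap) : ℤ := nc m - ec m / 2

/-- Planarity. -/
def planar (m : Fmap) : Prop := genus m = 0

/-- Breaking the latest forward k-link of x. -/
def B : Fmap → Dim → Nat → Fmap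
  | V, _, _ => V
  | I m0 x0, k, x => I (B m0 k x) x0
  | L m0 k0 x0 y0, k, x =>
      if k = k0 ∧ x = x0 then m0 else L (B m0 k x) k0 x0 y0

/-- Breaking all the 0-links of the darts of a list, first one first. -/
def Bl (m : Fmap) : List (Nat × Bool) → Fmap
  | [] => m
  | (x, _) :: l0 => Bl (B m Dim.zero x) l0

/-- The dart representing the face coded by a double-link (x, b). -/
def faceDart (m : Fmap) : Nat × Bool → Nat
  | (x, b) => if b then A m Dim.zero x else bottom m Dim.zero x

/-- The edge of x is distinct from the edges of the darts of a list. -/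
def distinct_edge_list (m : Fmap) (x : Nat) : List (Nat × Bool) → Prop
  | [] => True
  | (x', _) :: l0 => distinct_edge_list m x l0 ∧ ¬ expe m x x'

/-- Ring condition (0): unicity of edges, and each dart 0-linked. -/
def pre_ring0 (m : Fmap) : List (Nat × Bool) → Prop
  | [] => True
  | (x, _) :: l0 => pre_ring0 m l0 ∧ distinct_edge_list m x l0 ∧ succd m Dim.zero x

/-- Adjacency of the faces coded by two double-links. -/
def adjacent_faces (m : Fmap) : Nat × Bool → Nat × Bool → Prop
  | (x, b), (x', b') =>
      let y := A m Dim.zero x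
      let y' := A m Dim.zero x'
      let x0 := bottom m Dim.zero x
      let x'0 := bottom m Dim.zero x'
      if b then (if b' then expf m x0 y' else expf m x0 x'0)
      else (if b' then expf m y y' else expf m y x'0)

/-- Ring condition (1): continuity. -/
def pre_ring1 (m : Fmap) : List (Nat × Bool) → Prop
  | [] => True
  | xb :: l0 =>
      pre_ring1 m l0 ∧
      match l0 with
      | [] => True
      | xb' :: _ => adjacent_faces m xb xb'

/-- Last element of a list of double-links (with default). -/
def lastd : List (Nat × Bool) → Nat × Bool
  | [] => (nil, true)
  | [a] => a
  | _ :: a :: l0 => lastd (a :: l0)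

/-- Ring condition (2): circularity. -/
def pre_ring2 (m : Fmap) : List (Nat × Bool) → Prop
  | [] => True
  | (x, b) :: l0 =>
      match l0 with
      | [] => expf m (A m Dim.zero x) (bottom m Dim.zero x)
      | _ :: _ => adjacent_faces m (lastd l0) (x, b)

/-- The faces coded by two double-links are distinct. -/
def distinct_faces (m : Fmap) (xb xb' : Nat × Bool) : Prop :=
  ¬ expf m (faceDart m xb) (faceDart m xb')

/-- The face of xb is distinct from the faces of a list. -/
def distinct_face_list (m : Fmap) (xb : Nat × Bool) : List (Nat × Bool) → Prop
  | [] => True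
  | xb' :: l0 => distinct_face_list m xb l0 ∧ distinct_faces m xb xb'

/-- Ring condition (3): simplicity. -/
def pre_ring3 (m : Fmap) : List (Nat × Bool) → Prop
  | [] => True
  | xb :: l0 => pre_ring3 m l0 ∧ distinct_face_list m xb l0

/-- A ring of faces. -/
def ring (m : Fmap) (l : List (Nat × Bool)) : Prop :=
  l ≠ [] ∧ pre_ring0 m l ∧ pre_ring1 m l ∧ pre_ring2 m l ∧ pre_ring3 m l

end Fmap


namespace Fmap
open Equiv Equiv.Perm Relation

/-- Periodicity of a permutation. -/
def Per (σ : Perm ℕ) : Prop := ∀ z, ∃ n : ℕ, 0 < n ∧ (σ ^ n) z = z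

theorem per_of_fin (σ : Perm ℕ) (D : Finset ℕ) (h1 : ∀ z ∈ D, σ z ∈ D) (h2 : ∀ z, z ∉ D → σ z = z) :
    Per σ := by
  intro z
  by_cases hz : z ∈ D
  · have hmem : ∀ n : ℕ, (σ ^ n) z ∈ D := by
      intro n
      induction n with
      | zero => simpa using hz
      | succ n ih => rw [pow_succ', Perm.mul_apply]; exact h1 _ ih
    obtain ⟨i, j, hij, he⟩ := Finite.exists_ne_map_eq_of_infinite
      (fun n : ℕ => (⟨(σ ^ n) z, hmem n⟩ : D))
    simp only [Subtype.mk.injEq] at he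
    have key : ∀ i j : ℕ, i < j → (σ ^ i) z = (σ ^ j) z → ∃ n : ℕ, 0 < n ∧ (σ ^ n) z = z := by
      intro i j hlt he
      refine ⟨j - i, by omega, ?_⟩
      apply (σ ^ i).injective
      rw [← Perm.mul_apply, ← pow_add, he]
      congr 2; omega
    rcases lt_or_gt_of_ne hij with h | h
    · exact key i j h he
    · exact key j i h he.symm
  · exact ⟨1, one_pos, by simpa using h2 z hz⟩

theorem pow_mul_fix (σ : Perm ℕ) (z : ℕ) (n k : ℕ) (h : (σ ^ n) z = z) : (σ ^ (n * k)) z = z := by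
  induction k with
  | zero => simp
  | succ k ih => rw [Nat.mul_succ, pow_add, Perm.mul_apply, h, ih]

theorem same_nat {σ : Perm ℕ} (hp : Per σ) {a b : ℕ} :
    SameCycle σ a b ↔ ∃ n : ℕ, (σ ^ n) a = b := by
  constructor
  · rintro ⟨i, hi⟩
    obtain ⟨n, hn, hz⟩ := hp a
    have hf : ∀ k : ℕ, (σ ^ (n * k)) a = a := fun k => pow_mul_fix σ a n k hz
    refine ⟨(i + n * i.natAbs).toNat, ?_⟩
    rw [← hi]
    have hnn : 0 ≤ i + n * i.natAbs := by
      have : (i.natAbs : ℤ) ≤ n * i.natAbs := by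
        have : (1:ℤ) ≤ n := by exact_mod_cast hn
        nlinarith [Int.natCast_nonneg i.natAbs]
      omega
    rw [← zpow_natCast, Int.toNat_of_nonneg hnn, zpow_add, Perm.mul_apply]
    congr 1
    have := hf i.natAbs
    rw [← zpow_natCast] at this
    exact_mod_cast this
  · rintro ⟨n, hn⟩
    exact ⟨n, by simpa using hn⟩

theorem split_not_same {σ : Perm ℕ} {a b : ℕ} (hσ : Per σ) (hτ : Per (swap a b * σ)) (hab : a ≠ b)
    (h : SameCycle σ a b) : ¬ SameCycle (swap a b * σ) a b := by
  have hex := (same_nat hσ).1 h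
  set n := Nat.find hex with hn
  have hnb : (σ ^ n) a = b := Nat.find_spec hex
  have hmin : ∀ m < n, (σ ^ m) a ≠ b := fun m hm => Nat.find_min hex hm
  have hn0 : 0 < n := by
    rcases Nat.eq_zero_or_pos n with h0 | h0
    · rw [h0] at hnb; simp at hnb; exact absurd hnb hab
    · exact h0
  have hna : ∀ m, 0 < m → m < n → (σ ^ m) a ≠ a := by
    intro m hm hmn he
    apply hmin (n - m) (by omega)
    have : (σ ^ (n - m + m)) a = b := by rw [Nat.sub_add_cancel hmn.le]; exact hnb
    rw [pow_add, Perm.mul_apply, he] at this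
    exact this
  have hinv : ∀ k : ℕ, ∃ i < n, ((swap a b * σ) ^ k) a = (σ ^ i) a := by
    intro k
    induction k with
    | zero => exact ⟨0, hn0, by simp⟩
    | succ k ih =>
      obtain ⟨i, hi, he⟩ := ih
      rw [pow_succ', Perm.mul_apply, he, Perm.mul_apply, ← Perm.mul_apply σ, ← pow_succ']
      by_cases hin : i + 1 = n
      · exact ⟨0, hn0, by rw [hin, hnb]; simp⟩
      · refine ⟨i + 1, by omega, ?_⟩
        exact swap_apply_of_ne_of_ne (hna _ (by omega) (by omega)) (hmin _ (by omega))
  intro hc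
  obtain ⟨k, hk⟩ := (same_nat hτ).1 hc
  obtain ⟨i, hi, he⟩ := hinv k
  exact hmin i hi (he ▸ hk)

theorem merge_same_ab {σ : Perm ℕ} {a b : ℕ} (hσ : Per σ)
    (h : ¬ SameCycle σ a b) : SameCycle (swap a b * σ) a b := by
  have hex := hσ b
  set n := Nat.find hex with hn
  obtain ⟨hn0, hnb⟩ : 0 < n ∧ (σ ^ n) b = b := Nat.find_spec hex
  have hmin : ∀ m < n, 0 < m → (σ ^ m) b ≠ b := fun m hm h0 he => Nat.find_min hex hm ⟨h0, he⟩
  have hna : ∀ m : ℕ, (σ ^ m) b ≠ a := by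
    intro m he
    exact h (SameCycle.symm ⟨m, by simpa using he⟩)
  have key : ∀ i < n, ((swap a b * σ) ^ i) b = (σ ^ i) b := by
    intro i
    induction i with
    | zero => simp
    | succ i ih =>
      intro hi
      rw [pow_succ', Perm.mul_apply, ih (by omega), Perm.mul_apply, ← Perm.mul_apply σ, ← pow_succ']
      exact swap_apply_of_ne_of_ne (hna _) (hmin _ hi (by omega))
  apply SameCycle.symm
  refine ⟨n, ?_⟩
  rw [zpow_natCast]
  clear_value n
  obtain ⟨k, rfl⟩ : ∃ k, n = k + 1 := ⟨n - 1, by omega⟩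
  rw [pow_succ', Perm.mul_apply, key k (by omega), Perm.mul_apply, ← Perm.mul_apply σ, ← pow_succ', hnb]
  simp

/-- Adding a pair to a relation. -/
def Jn (r : ℕ → ℕ → Prop) (a b z t : ℕ) : Prop := r z t ∨ (r z a ∧ r b t) ∨ (r z b ∧ r a t)

theorem same_of_step {σ : Perm ℕ} (hp : Per σ) {r : ℕ → ℕ → Prop} (hr : Equivalence r)
    (h : ∀ z, r z (σ z)) {z t : ℕ} (hs : SameCycle σ z t) : r z t := by
  obtain ⟨n, rfl⟩ := (same_nat hp).1 hs
  induction n with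
  | zero => simpa using hr.refl z
  | succ n ih =>
    rw [pow_succ', Perm.mul_apply]
    exact hr.trans (ih ⟨n, by simp⟩) (h _)

theorem Jn_equiv {r : ℕ → ℕ → Prop} (hr : Equivalence r) (a b : ℕ) : Equivalence (Jn r a b) := by
  have hs := @hr.symm
  have ht := @hr.trans
  have h0 := hr.refl
  refine ⟨fun x => Or.inl (h0 x), ?_, ?_⟩
  · intro x y h
    rcases h with h | ⟨h, h'⟩ | ⟨h, h'⟩
    · exact Or.inl (hs h)
    · exact Or.inr (Or.inr ⟨hs h', hs h⟩)
    · exact Or.inr (Or.inl ⟨hs h', hs h⟩)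
  · intro x y z h k
    rcases h with h | ⟨h, h'⟩ | ⟨h, h'⟩ <;> rcases k with k | ⟨k, k'⟩ | ⟨k, k'⟩
    · exact Or.inl (ht h k)
    · exact Or.inr (Or.inl ⟨ht h k, k'⟩)
    · exact Or.inr (Or.inr ⟨ht h k, k'⟩)
    · exact Or.inr (Or.inl ⟨h, ht h' k⟩)
    · exact Or.inl (ht h (ht (hs (ht h' k)) k'))
    · exact Or.inl (ht h k')
    · exact Or.inr (Or.inr ⟨h, ht h' k⟩)
    · exact Or.inl (ht h k')
    · exact Or.inl (ht h (ht (hs (ht h' k)) k'))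

theorem same_equiv (σ : Perm ℕ) : Equivalence (SameCycle σ) :=
  ⟨fun x => SameCycle.refl σ x, fun h => h.symm, fun h k => h.trans k⟩

theorem merge_iff {σ : Perm ℕ} {a b : ℕ} (hσ : Per σ) (hτ : Per (swap a b * σ))
    (h : ¬ SameCycle σ a b) (z t : ℕ) :
    SameCycle (swap a b * σ) z t ↔ Jn (SameCycle σ) a b z t := by
  have hab := merge_same_ab hσ h
  have hsub : ∀ z t, SameCycle σ z t → SameCycle (swap a b * σ) z t := by
    intro z t hs
    refine same_of_step hσ (same_equiv _) ?_ hs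
    intro z
    have h1 : SameCycle (swap a b * σ) z ((swap a b * σ) z) := ⟨1, by simp⟩
    refine h1.trans ?_
    rw [Perm.mul_apply]
    by_cases ha : σ z = a
    · rw [ha, swap_apply_left]; exact hab.symm
    · by_cases hb : σ z = b
      · rw [hb, swap_apply_right]; exact hab
      · rw [swap_apply_of_ne_of_ne ha hb]
  constructor
  · intro hs
    refine same_of_step hτ (Jn_equiv (same_equiv σ) a b) ?_ hs
    intro z
    have h1 : SameCycle σ z (σ z) := ⟨1, by simp⟩
    rw [Perm.mul_apply]
    by_cases ha : σ z = a
    · rw [ha, swap_apply_left]; rw [ha] at h1; exact Or.inr (Or.inl ⟨h1, SameCycle.refl _ _⟩)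
    · by_cases hb : σ z = b
      · rw [hb, swap_apply_right]; rw [hb] at h1; exact Or.inr (Or.inr ⟨h1, SameCycle.refl _ _⟩)
      · rw [swap_apply_of_ne_of_ne ha hb]; exact Or.inl h1
  · rintro (h | ⟨h, h'⟩ | ⟨h, h'⟩)
    · exact hsub _ _ h
    · exact (hsub _ _ h).trans (hab.trans (hsub _ _ h'))
    · exact (hsub _ _ h).trans (hab.symm.trans (hsub _ _ h'))

/-- Number of classes, via least representatives. -/
noncomputable def cnt (r : ℕ → ℕ → Prop) (D : Finset ℕ) : ℤ :=
  ((D.filter (fun z => ∀ t ∈ D, r z t → z ≤ t)).card : ℤ)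

/-- Equivalence on a finite set of darts. -/
structure EqOn (r : ℕ → ℕ → Prop) (D : Finset ℕ) : Prop where
  refl : ∀ z ∈ D, r z z
  symm : ∀ z t, r z t → r t z
  trans : ∀ z t u, r z t → r t u → r z u

theorem exists_min {r : ℕ → ℕ → Prop} {D : Finset ℕ} (hr : EqOn r D) {a : ℕ} (ha : a ∈ D) :
    ∃ p ∈ D, r a p ∧ ∀ t ∈ D, r p t → p ≤ t := by
  have hex : ∃ p, p ∈ D ∧ r a p := ⟨a, ha, hr.refl a ha⟩
  refine ⟨Nat.find hex, (Nat.find_spec hex).1, (Nat.find_spec hex).2, ?_⟩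
  intro t ht h
  exact Nat.find_min' hex ⟨ht, hr.trans _ _ _ (Nat.find_spec hex).2 h⟩

theorem cnt_congr {r r' : ℕ → ℕ → Prop} {D : Finset ℕ}
    (h : ∀ z ∈ D, ∀ t ∈ D, (r z t ↔ r' z t)) : cnt r D = cnt r' D := by
  unfold cnt
  congr 2
  apply Finset.filter_congr
  intro z hz
  exact forall₂_congr fun t ht => by rw [h z hz t ht]

theorem cnt_merge {r r' : ℕ → ℕ → Prop} {D : Finset ℕ} (hr : EqOn r D) {a b : ℕ}
    (ha : a ∈ D) (hb : b ∈ D) (hab : ¬ r a b)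
    (h : ∀ z ∈ D, ∀ t ∈ D, (r' z t ↔ Jn r a b z t)) : cnt r' D = cnt r D - 1 := by
  obtain ⟨p, hp, hap, hpm⟩ := exists_min hr ha
  obtain ⟨q, hq, hbq, hqm⟩ := exists_min hr hb
  have main : ∀ a b p q : ℕ, a ∈ D → b ∈ D → ¬ r a b → p ∈ D → r a p → (∀ t ∈ D, r p t → p ≤ t) →
      q ∈ D → r b q → (∀ t ∈ D, r q t → q ≤ t) → p ≤ q →
      (∀ z ∈ D, ∀ t ∈ D, (r' z t ↔ Jn r a b z t)) → cnt r' D = cnt r D - 1 := by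
    intro a b p q ha hb hab hp hap hpm hq hbq hqm hpq h
    have hne : p ≠ q := by
      rintro rfl
      exact hab (hr.trans _ _ _ hap (hr.symm _ _ hbq))
    have hmem : q ∈ D.filter (fun z => ∀ t ∈ D, r z t → z ≤ t) := by
      simp only [Finset.mem_filter]; exact ⟨hq, hqm⟩
    have heq : D.filter (fun z => ∀ t ∈ D, r' z t → z ≤ t)
        = (D.filter (fun z => ∀ t ∈ D, r z t → z ≤ t)).erase q := by
      ext z
      simp only [Finset.mem_filter, Finset.mem_erase]
      constructor
      · rintro ⟨hz, hm⟩
        refine ⟨?_, hz, fun t ht hzt => hm t ht ((h z hz t ht).2 (Or.inl hzt))⟩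
        rintro rfl
        have := hm p hp ((h z hz p hp).2 (Or.inr (Or.inr ⟨hr.symm _ _ hbq, hap⟩)))
        omega
      · rintro ⟨hzq, hz, hm⟩
        refine ⟨hz, fun t ht hzt => ?_⟩
        rcases (h z hz t ht).1 hzt with h | ⟨h1, h2⟩ | ⟨h1, h2⟩
        · exact hm t ht h
        · have e1 := hm p hp (hr.trans _ _ _ h1 hap)
          have e2 := hqm t ht (hr.trans _ _ _ (hr.symm _ _ hbq) h2)
          omega
        · exfalso
          apply hzq
          have e1 := hm q hq (hr.trans _ _ _ h1 hbq)
          have e2 := hqm z hz (hr.trans _ _ _ (hr.symm _ _ hbq) (hr.symm _ _ h1))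
          omega
    unfold cnt
    rw [heq, Finset.card_erase_of_mem hmem]
    have : 0 < (D.filter (fun z => ∀ t ∈ D, r z t → z ≤ t)).card := Finset.card_pos.2 ⟨q, hmem⟩
    omega
  rcases le_total p q with hpq | hpq
  · exact main a b p q ha hb hab hp hap hpm hq hbq hqm hpq h
  · refine main b a q p hb ha (fun k => hab (hr.symm _ _ k)) hq hbq hqm hp hap hpm hpq ?_
    intro z hz t ht
    rw [h z hz t ht]
    unfold Jn
    tauto

theorem cnt_insert {r r' : ℕ → ℕ → Prop} {D : Finset ℕ} {x : ℕ} (hx : x ∉ D)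
    (h : ∀ z ∈ D, ∀ t ∈ D, (r' z t ↔ r z t)) (h1 : ∀ z ∈ D, ¬ r' z x) (h2 : ∀ z ∈ D, ¬ r' x z) :
    cnt r' (insert x D) = cnt r D + 1 := by
  have heq : (insert x D).filter (fun z => ∀ t ∈ insert x D, r' z t → z ≤ t)
      = insert x (D.filter (fun z => ∀ t ∈ D, r z t → z ≤ t)) := by
    ext z
    simp only [Finset.mem_filter, Finset.mem_insert]
    constructor
    · rintro ⟨rfl | hz, hm⟩
      · exact Or.inl rfl
      · exact Or.inr ⟨hz, fun t ht hzt => hm t (Or.inr ht) ((h z hz t ht).2 hzt)⟩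
    · rintro (rfl | ⟨hz, hm⟩)
      · refine ⟨Or.inl rfl, ?_⟩
        rintro t (rfl | ht) hzt
        · exact le_rfl
        · exact absurd hzt (h2 t ht)
      · refine ⟨Or.inr hz, ?_⟩
        rintro t (rfl | ht) hzt
        · exact absurd hzt (h1 z hz)
        · exact hm t ht ((h z hz t ht).1 hzt)
  unfold cnt
  rw [heq, Finset.card_insert_of_notMem]
  · push_cast; rfl
  · simp [hx]

theorem cnt_perm {σ τ : Perm ℕ} {D : Finset ℕ} {a b : ℕ} (hσ : Per σ) (hτ : Per τ)
    (e : τ = swap a b * σ) (ha : a ∈ D) (hb : b ∈ D) (hab : a ≠ b) :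
    cnt (SameCycle τ) D = if SameCycle σ a b then cnt (SameCycle σ) D + 1
      else cnt (SameCycle σ) D - 1 := by
  have hE : ∀ σ : Perm ℕ, EqOn (SameCycle σ) D := fun σ =>
    ⟨fun z _ => SameCycle.refl σ z, fun z t h => h.symm, fun z t u h k => h.trans k⟩
  split_ifs with h
  · have hn : ¬ SameCycle τ a b := by
      rw [e]; exact split_not_same hσ (e ▸ hτ) hab h
    have e' : σ = swap a b * τ := by rw [e, ← mul_assoc, swap_mul_self, one_mul]
    have := cnt_merge (r' := SameCycle σ) (hE τ) ha hb hn (by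
      intro z _ t _
      conv_lhs => rw [e']
      exact merge_iff hτ (e' ▸ hσ) hn z t)
    omega
  · exact cnt_merge (hE σ) ha hb h (by
      intro z _ t _
      rw [e]
      exact merge_iff hσ (e ▸ hτ) h z t)

end Fmap

namespace Fmap
open Equiv Equiv.Perm Relation

/-- One-step k-link. -/
def R (m : Fmap) (k : Dim) (u v : ℕ) : Prop := A m k u = v ∧ v ≠ nil

theorem exd_ne_nil {m : Fmap} (h : inv_hmap m) {z : ℕ} (hz : exd m z) : z ≠ nil := by
  induction m with
  | V => exact absurd hz id
  | I m0 x ih =>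
    rcases hz with rfl | hz
    · exact h.2.1
    · exact ih h.1 hz
  | L m0 k x y ih => exact ih h.1 hz

theorem R_exd {m : Fmap} (h : inv_hmap m) {k : Dim} {u v : ℕ} (hr : R m k u v) :
    exd m u ∧ exd m v := by
  induction m with
  | V => exact absurd hr.1.symm hr.2
  | I m0 x ih => exact ⟨Or.inr (ih h.1 hr).1, Or.inr (ih h.1 hr).2⟩
  | L m0 k0 x y ih =>
    obtain ⟨h1, h2⟩ := hr
    simp only [A] at h1
    split_ifs at h1 with e1 e2
    · subst e2; subst h1; exact ⟨h.2.1, h.2.2.1⟩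
    · exact ih h.1 ⟨h1, h2⟩
    · exact ih h.1 ⟨h1, h2⟩

theorem R_iff_pred {m : Fmap} (h : inv_hmap m) {k : Dim} {u v : ℕ} :
    R m k u v ↔ A_1 m k v = u ∧ u ≠ nil := by
  induction m with
  | V => constructor
         · intro hr; exact absurd hr.1.symm hr.2
         · intro hr; exact absurd hr.1.symm hr.2
  | I m0 x ih => exact ih h.1
  | L m0 k0 x y ih =>
    have ih := ih h.1
    have hx := exd_ne_nil h.1 h.2.1
    have hy := exd_ne_nil h.1 h.2.2.1
    unfold R at *
    simp only [A, A_1]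
    by_cases e1 : k = k0
    · subst e1
      have hs : A m0 k x = nil := not_not.1 h.2.2.2.1
      have hp : A_1 m0 k y = nil := not_not.1 h.2.2.2.2.1
      simp only [if_true]
      split_ifs with e2 e3 e3
      · subst e2; subst e3; simp [hx, hy]
      · subst e2
        constructor
        · rintro ⟨rfl, _⟩; exact absurd rfl e3
        · intro hr
          have := ih.2 hr
          rw [hs] at this
          exact absurd this.1.symm this.2
      · subst e3
        constructor
        · intro hr
          have := ih.1 hr
          rw [hp] at this
          exact absurd this.1.symm this.2
        · rintro ⟨rfl, _⟩; exact absurd rfl e2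
      · exact ih
    · simp only [e1, if_false]; exact ih

theorem R_inj {m : Fmap} (h : inv_hmap m) {k : Dim} {u u' v : ℕ} (h1 : R m k u v) (h2 : R m k u' v) :
    u = u' := by
  rw [R_iff_pred h] at h1 h2
  rw [← h1.1, h2.1]

theorem R_fun {m : Fmap} {k : Dim} {u v v' : ℕ} (h1 : R m k u v) (h2 : R m k u v') : v = v' := by
  rw [← h1.1, h2.1]

theorem predd_iff {m : Fmap} (h : inv_hmap m) {k : Dim} {v : ℕ} : predd m k v ↔ ∃ u, R m k u v := by
  constructor
  · intro hp; exact ⟨_, (R_iff_pred h).2 ⟨rfl, hp⟩⟩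
  · rintro ⟨u, hu⟩
    have := (R_iff_pred h).1 hu
    unfold predd; rw [this.1]; exact this.2

theorem succd_iff {m : Fmap} {k : Dim} {u : ℕ} : succd m k u ↔ ∃ v, R m k u v := by
  constructor
  · intro hp; exact ⟨_, rfl, hp⟩
  · rintro ⟨v, hv⟩
    unfold succd; rw [hv.1]; exact hv.2

abbrev RT (m : Fmap) (k : Dim) := ReflTransGen (R m k)

theorem top_unique {m : Fmap} {k : Dim} {z t t' : ℕ} (h1 : RT m k z t) (h2 : RT m k z t')
    (n1 : ¬ succd m k t) (n2 : ¬ succd m k t') : t = t' := by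
  rcases ReflTransGen.total_of_right_unique (r := R m k) (fun _ _ _ a b => R_fun a b) h1 h2 with h | h
  · rcases ReflTransGen.cases_head h with h | ⟨c, hc, _⟩
    · exact h
    · exact absurd (succd_iff.2 ⟨c, hc⟩) n1
  · rcases ReflTransGen.cases_head h with h | ⟨c, hc, _⟩
    · exact h.symm
    · exact absurd (succd_iff.2 ⟨c, hc⟩) n2

theorem bot_unique {m : Fmap} (hm : inv_hmap m) {k : Dim} {z t t' : ℕ} (h1 : RT m k t z)
    (h2 : RT m k t' z)
    (n1 : ¬ predd m k t) (n2 : ¬ predd m k t') : t = t' := by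
  have g1 := reflTransGen_swap.2 h1
  have g2 := reflTransGen_swap.2 h2
  rcases ReflTransGen.total_of_right_unique (r := Function.swap (R m k))
    (fun _ _ _ a b => R_inj hm a b) g1 g2 with h | h
  · rcases ReflTransGen.cases_head h with h | ⟨c, hc, _⟩
    · exact h
    · exact absurd ((predd_iff hm).2 ⟨c, hc⟩) n1
  · rcases ReflTransGen.cases_head h with h | ⟨c, hc, _⟩
    · exact h.symm
    · exact absurd ((predd_iff hm).2 ⟨c, hc⟩) n2

theorem R_L {m0 : Fmap} {k0 k : Dim} {x y u v : ℕ} (h : inv_hmap (L m0 k0 x y)) :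
    R (L m0 k0 x y) k u v ↔ R m0 k u v ∨ (k = k0 ∧ u = x ∧ v = y) := by
  have hy := exd_ne_nil h.1 h.2.2.1
  unfold R
  simp only [A]
  by_cases e1 : k = k0
  · subst e1
    have hs : A m0 k x = nil := not_not.1 h.2.2.2.1
    by_cases e2 : u = x
    · subst e2
      simp only [if_true, hs]
      constructor
      · rintro ⟨rfl, _⟩; simp
      · rintro (⟨h1, h2⟩ | ⟨_, _, rfl⟩)
        · exact absurd h1.symm h2
        · exact ⟨rfl, hy⟩
    · simp [e2]
  · simp [e1]

theorem RT_exd {m : Fmap} (h : inv_hmap m) {k : Dim} {u v : ℕ} (hr : RT m k u v) :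
    exd m u ↔ exd m v := by
  induction hr with
  | refl => rfl
  | tail _ h2 ih => rw [ih]; exact ⟨fun _ => (R_exd h h2).2, fun _ => (R_exd h h2).1⟩

theorem RT_mono {m m' : Fmap} {k : Dim} (hR : ∀ u v, R m k u v → R m' k u v) {u v : ℕ}
    (h : RT m k u v) : RT m' k u v := ReflTransGen.mono hR _ _ h

/-- Specification of the orbit functions. -/
structure Spec (m : Fmap) (k : Dim) (z : ℕ) : Prop where
  be : exd m (bottom m k z)
  bp : ¬ predd m k (bottom m k z)
  br : RT m k (bottom m k z) z
  te : exd m (top m k z)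
  ts : ¬ succd m k (top m k z)
  tr : RT m k z (top m k z)
  ca : cA m k z = if A m k z = nil then bottom m k z else A m k z
  ca' : cA_1 m k z = if A_1 m k z = nil then top m k z else A_1 m k z

theorem spec {m : Fmap} (h : inv_hmap m) (k : Dim) {z : ℕ} (hz : exd m z) : Spec m k z := by
  induction m generalizing z with
  | V => exact absurd hz id
  | I m0 x ih =>
    have hRI : ∀ u v, R m0 k u v → R (I m0 x) k u v := fun u v h => h
    by_cases e : z = x
    · subst e
      have hp : ¬ predd (I m0 z) k z := by
        rw [predd_iff h]
        rintro ⟨u, hu⟩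
        exact h.2.2 (R_exd (m := m0) h.1 hu).2
      have hs : ¬ succd (I m0 z) k z := by
        rw [succd_iff]
        rintro ⟨u, hu⟩
        exact h.2.2 (R_exd (m := m0) h.1 hu).1
      have hb : bottom (I m0 z) k z = z := by simp [bottom]
      have ht : top (I m0 z) k z = z := by simp [top]
      refine ⟨?_, ?_, ?_, ?_, ?_, ?_, ?_, ?_⟩
      · rw [hb]; exact Or.inl rfl
      · rw [hb]; exact hp
      · rw [hb]
      · rw [ht]; exact Or.inl rfl
      · rw [ht]; exact hs
      · rw [ht]
      · rw [if_pos (not_not.1 hs), hb]; simp [cA]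
      · rw [if_pos (not_not.1 hp), ht]; simp [cA_1]
    · have s := ih h.1 (hz.resolve_left e)
      have hb : bottom (I m0 x) k z = bottom m0 k z := by simp [bottom, e]
      have ht : top (I m0 x) k z = top m0 k z := by simp [top, e]
      refine ⟨?_, ?_, ?_, ?_, ?_, ?_, ?_, ?_⟩
      · rw [hb]; exact Or.inr s.be
      · rw [hb]; exact s.bp
      · rw [hb]; exact s.br
      · rw [ht]; exact Or.inr s.te
      · rw [ht]; exact s.ts
      · rw [ht]; exact s.tr
      · rw [hb]; simp only [cA, e, if_false]; exact s.ca
      · rw [ht]; simp only [cA_1, e, if_false]; exact s.ca'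
  | L m0 k0 x y ih =>
    have hRL : ∀ u v, R m0 k u v → R (L m0 k0 x y) k u v := fun u v hr => (R_L h).2 (Or.inl hr)
    have s := ih h.1 hz
    have sx := ih h.1 h.2.1
    have sy := ih h.1 h.2.2.1
    have hpred : ∀ w, ¬ predd m0 k w → ¬ (k = k0 ∧ w = y) → ¬ predd (L m0 k0 x y) k w := by
      intro w h1 h2 h3
      obtain ⟨u, hu⟩ := (predd_iff h).1 h3
      rcases (R_L h).1 hu with hu | ⟨hk, _, hv⟩
      · exact h1 ((predd_iff h.1).2 ⟨u, hu⟩)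
      · exact h2 ⟨hk, hv⟩
    have hsucc : ∀ w, ¬ succd m0 k w → ¬ (k = k0 ∧ w = x) → ¬ succd (L m0 k0 x y) k w := by
      intro w h1 h2 h3
      obtain ⟨u, hu⟩ := succd_iff.1 h3
      rcases (R_L h).1 hu with hu | ⟨hk, hv, _⟩
      · exact h1 (succd_iff.2 ⟨u, hu⟩)
      · exact h2 ⟨hk, hv⟩
    by_cases e1 : k = k0
    · subst e1
      have hs : ¬ succd m0 k x := h.2.2.2.1
      have hp : ¬ predd m0 k y := h.2.2.2.2.1
      have hxy : bottom m0 k x ≠ y := by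
        have := h.2.2.2.2.2
        rw [sx.ca, if_pos (not_not.1 hs)] at this
        exact this
      have hyx : top m0 k y ≠ x := by
        intro e
        have := sy.tr
        rw [e] at this
        exact hxy (bot_unique h.1 sx.br this sx.bp hp)
      have hlink : R (L m0 k x y) k x y := (R_L h).2 (Or.inr ⟨rfl, rfl, rfl⟩)
      have hby : bottom m0 k z = y → RT m0 k y z := fun e => by
        have := s.br; rwa [e] at this
      have htx : top m0 k z = x → RT m0 k z x := fun e => by
        have := s.tr; rwa [e] at this
      have hb : bottom (L m0 k x y) k z
        = if bottom m0 k z = y then bottom m0 k x else bottom m0 k z := by simp [bottom]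
      have ht : top (L m0 k x y) k z
        = if top m0 k z = x then top m0 k y else top m0 k z := by simp [top]
      refine ⟨?_, ?_, ?_, ?_, ?_, ?_, ?_, ?_⟩
      · rw [hb]; split_ifs; exacts [sx.be, s.be]
      · rw [hb]; split_ifs with e2
        · exact hpred _ sx.bp (fun hh => hxy hh.2)
        · exact hpred _ s.bp (fun hh => e2 hh.2)
      · rw [hb]; split_ifs with e2
        · exact (RT_mono hRL sx.br).trans (ReflTransGen.head hlink (RT_mono hRL (hby e2)))
        · exact RT_mono hRL s.br
      · rw [ht]; split_ifs; exacts [sy.te, s.te]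
      · rw [ht]; split_ifs with e2
        · exact hsucc _ sy.ts (fun hh => hyx hh.2)
        · exact hsucc _ s.ts (fun hh => e2 hh.2)
      · rw [ht]; split_ifs with e2
        · exact (RT_mono hRL (htx e2)).trans (ReflTransGen.head hlink (RT_mono hRL sy.tr))
        · exact RT_mono hRL s.tr
      · rw [hb]
        simp only [cA, A, if_true]
        by_cases ez : z = x
        · simp [ez, exd_ne_nil h.1 h.2.2.1]
        · simp only [ez, if_false]
          by_cases et : z = top m0 k y
          · have hA : A m0 k z = nil := by rw [et]; exact not_not.1 sy.ts
            have hbz : bottom m0 k z = y := bot_unique h.1 s.br (et ▸ sy.tr) s.bp hp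
            rw [if_pos et, if_pos hA, if_pos hbz]
          · rw [if_neg et, s.ca]
            split_ifs with e3 e4
            · exfalso; apply et
              exact top_unique (hby e4) sy.tr (not_not.2 e3) sy.ts
            · rfl
            · rfl
      · rw [ht]
        simp only [cA_1, A_1, if_true]
        by_cases ez : z = y
        · simp [ez, exd_ne_nil h.1 h.2.1]
        · simp only [ez, if_false]
          by_cases et : z = bottom m0 k x
          · have hA : A_1 m0 k z = nil := by rw [et]; exact not_not.1 sx.bp
            have hbz : top m0 k z = x := top_unique s.tr (et ▸ sx.br) s.ts hs
            rw [if_pos et, if_pos hA, if_pos hbz]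
          · rw [if_neg et, s.ca']
            split_ifs with e3 e4
            · exfalso; apply et
              exact bot_unique h.1 (htx e4) sx.br (not_not.2 e3) sx.bp
            · rfl
            · rfl
    · have hb : bottom (L m0 k0 x y) k z = bottom m0 k z := by simp [bottom, e1]
      have ht : top (L m0 k0 x y) k z = top m0 k z := by simp [top, e1]
      refine ⟨?_, ?_, ?_, ?_, ?_, ?_, ?_, ?_⟩
      · rw [hb]; exact s.be
      · rw [hb]; exact hpred _ s.bp (fun hh => e1 hh.1)
      · rw [hb]; exact RT_mono hRL s.br
      · rw [ht]; exact s.te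
      · rw [ht]; exact hsucc _ s.ts (fun hh => e1 hh.1)
      · rw [ht]; exact RT_mono hRL s.tr
      · rw [hb]; simp only [cA, A, e1, if_false]; exact s.ca
      · rw [ht]; simp only [cA_1, A_1, e1, if_false]; exact s.ca'

theorem out_spec {m : Fmap} (h : inv_hmap m) (k : Dim) {z : ℕ} (hz : ¬ exd m z) :
    bottom m k z = nil ∧ top m k z = nil ∧ cA m k z = nil ∧ cA_1 m k z = nil := by
  induction m with
  | V => exact ⟨rfl, rfl, rfl, rfl⟩
  | I m0 x ih =>
    have h1 : z ≠ x := fun e => hz (Or.inl e)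
    simpa [bottom, top, cA, cA_1, h1] using ih h.1 (fun e => hz (Or.inr e))
  | L m0 k0 x y ih =>
    have i := ih h.1 hz
    have hx := exd_ne_nil h.1 h.2.1
    have hy := exd_ne_nil h.1 h.2.2.1
    have zx : z ≠ x := fun e => hz (e ▸ h.2.1)
    have zy : z ≠ y := fun e => hz (e ▸ h.2.2.1)
    have zt : z ≠ top m0 k y := fun e => hz (e ▸ (spec h.1 k h.2.2.1).te)
    have zb : z ≠ bottom m0 k x := fun e => hz (e ▸ (spec h.1 k h.2.1).be)
    simp [bottom, top, cA, cA_1, i, zx, zy, zt, zb, hx.symm, hy.symm]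

/-- Semantic equality of hypermaps. -/
structure Sim (m m' : Fmap) : Prop where
  e : ∀ z, exd m z ↔ exd m' z
  a : ∀ k z, A m k z = A m' k z

theorem Sim.R {m m' : Fmap} (s : Sim m m') (k : Dim) : R m k = R m' k := by
  funext u v; unfold Fmap.R; rw [s.a]

theorem Sim.A_1 {m m' : Fmap} (h : inv_hmap m) (h' : inv_hmap m') (s : Sim m m') (k : Dim) (z : ℕ) :
    A_1 m k z = A_1 m' k z := by
  by_cases e : Fmap.A_1 m k z = nil
  · by_contra hne
    have e' : Fmap.A_1 m' k z ≠ nil := fun e' => hne (e.trans e'.symm)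
    have := (R_iff_pred h').2 ⟨rfl, e'⟩
    rw [← s.R, R_iff_pred h] at this
    exact this.2 (this.1.symm.trans e)
  · have := (R_iff_pred h).2 ⟨rfl, e⟩
    rw [s.R, R_iff_pred h'] at this
    exact this.1.symm

theorem Sim.all {m m' : Fmap} (h : inv_hmap m) (h' : inv_hmap m') (s : Sim m m') (k : Dim) (z : ℕ) :
    bottom m k z = bottom m' k z ∧ top m k z = top m' k z ∧ cA m k z = cA m' k z ∧
      cA_1 m k z = cA_1 m' k z := by
  by_cases hz : exd m z
  · have p := spec h k hz
    have p' := spec h' k ((s.e z).1 hz)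
    have hb : bottom m k z = bottom m' k z := by
      refine bot_unique h p.br ?_ p.bp ?_
      · rw [RT, s.R]; exact p'.br
      · have := p'.bp; unfold predd at *; rwa [s.A_1 h h']
    have ht : top m k z = top m' k z := by
      refine top_unique p.tr ?_ p.ts ?_
      · rw [RT, s.R]; exact p'.tr
      · have := p'.ts; unfold succd at *; rwa [s.a]
    refine ⟨hb, ht, ?_, ?_⟩
    · rw [p.ca, p'.ca, hb, s.a]
    · rw [p.ca', p'.ca', ht, s.A_1 h h']
  · have o := out_spec h k hz
    have o' := out_spec h' k (fun hh => hz ((s.e z).2 hh))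
    exact ⟨o.1.trans o'.1.symm, o.2.1.trans o'.2.1.symm, o.2.2.1.trans o'.2.2.1.symm,
      o.2.2.2.trans o'.2.2.2.symm⟩

end Fmap

namespace Fmap
open Equiv Equiv.Perm Relation

theorem cA_exd {m : Fmap} (h : inv_hmap m) (k : Dim) {z : ℕ} (hz : exd m z) : exd m (cA m k z) := by
  have s := spec h k hz
  rw [s.ca]
  split_ifs with e
  · exact s.be
  · exact (R_exd h ⟨rfl, e⟩).2

theorem cA_1_exd {m : Fmap} (h : inv_hmap m) (k : Dim) {z : ℕ} (hz : exd m z) :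
    exd m (cA_1 m k z) := by
  have s := spec h k hz
  rw [s.ca']
  split_ifs with e
  · exact s.te
  · exact (R_exd h ((R_iff_pred h).2 ⟨rfl, e⟩)).1

theorem bottom_of_RT {m : Fmap} (h : inv_hmap m) {k : Dim} {b z : ℕ} (hz : exd m z)
    (hr : RT m k b z) (hp : ¬ predd m k b) : bottom m k z = b :=
  bot_unique h (spec h k hz).br hr (spec h k hz).bp hp

theorem top_of_RT {m : Fmap} (h : inv_hmap m) {k : Dim} {t z : ℕ} (hz : exd m z)
    (hr : RT m k z t) (hp : ¬ succd m k t) : top m k z = t :=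
  top_unique (spec h k hz).tr hr (spec h k hz).ts hp

theorem cA_1_cA {m : Fmap} (h : inv_hmap m) (k : Dim) {z : ℕ} (hz : exd m z) :
    cA_1 m k (cA m k z) = z := by
  have s := spec h k hz
  rw [(spec h k (cA_exd h k hz)).ca', s.ca]
  by_cases e : A m k z = nil
  · rw [if_pos e, if_pos (not_not.1 s.bp)]
    exact top_of_RT h s.be s.br (not_not.2 e)
  · rw [if_neg e]
    have := (R_iff_pred h).1 (⟨rfl, e⟩ : R m k z (A m k z))
    rw [if_neg (this.1.symm ▸ this.2), this.1]

theorem cA_cA_1 {m : Fmap} (h : inv_hmap m) (k : Dim) {z : ℕ} (hz : exd m z) :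
    cA m k (cA_1 m k z) = z := by
  have s := spec h k hz
  rw [(spec h k (cA_1_exd h k hz)).ca, s.ca']
  by_cases e : A_1 m k z = nil
  · rw [if_pos e, if_pos (not_not.1 s.ts)]
    exact bottom_of_RT h s.te s.tr (not_not.2 e)
  · rw [if_neg e]
    have := (R_iff_pred h).2 ⟨rfl, e⟩
    rw [if_neg (this.1.symm ▸ this.2), this.1]

/-- cA as a permutation of all naturals. -/
noncomputable def P (m : Fmap) (h : inv_hmap m) (k : Dim) : Perm ℕ where
  toFun z := if exd m z then cA m k z else z
  invFun z := if exd m z then cA_1 m k z else z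
  left_inv z := by
    by_cases hz : exd m z
    · simp [hz, cA_exd h k hz, cA_1_cA h k hz]
    · simp [hz]
  right_inv z := by
    by_cases hz : exd m z
    · simp [hz, cA_1_exd h k hz, cA_cA_1 h k hz]
    · simp [hz]

theorem P_in {m : Fmap} (h : inv_hmap m) (k : Dim) {z : ℕ} (hz : exd m z) :
    P m h k z = cA m k z := by
  change (if exd m z then cA m k z else z) = _
  rw [if_pos hz]

theorem P_out {m : Fmap} (h : inv_hmap m) (k : Dim) {z : ℕ} (hz : ¬ exd m z) :
    P m h k z = z := by
  change (if exd m z then cA m k z else z) = _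
  rw [if_neg hz]

theorem Pi_in {m : Fmap} (h : inv_hmap m) (k : Dim) {z : ℕ} (hz : exd m z) :
    (P m h k)⁻¹ z = cA_1 m k z := by
  change (if exd m z then cA_1 m k z else z) = _
  rw [if_pos hz]

theorem Pi_out {m : Fmap} (h : inv_hmap m) (k : Dim) {z : ℕ} (hz : ¬ exd m z) :
    (P m h k)⁻¹ z = z := by
  change (if exd m z then cA_1 m k z else z) = _
  rw [if_neg hz]

/-- Face permutation. -/
noncomputable def Pf (m : Fmap) (h : inv_hmap m) : Perm ℕ := (P m h Dim.one)⁻¹ * (P m h Dim.zero)⁻¹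

theorem Pf_in {m : Fmap} (h : inv_hmap m) {z : ℕ} (hz : exd m z) : Pf m h z = cF m z := by
  rw [Pf, Perm.mul_apply, Pi_in h _ hz, Pi_in h _ (cA_1_exd h _ hz), cF]

theorem Pf_out {m : Fmap} (h : inv_hmap m) {z : ℕ} (hz : ¬ exd m z) : Pf m h z = z := by
  rw [Pf, Perm.mul_apply, Pi_out h _ hz, Pi_out h _ hz]

theorem cF_exd {m : Fmap} (h : inv_hmap m) {z : ℕ} (hz : exd m z) : exd m (cF m z) :=
  cA_1_exd h _ (cA_1_exd h _ hz)

/-- Finite set of darts. -/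
def dom : Fmap → Finset ℕ
  | V => ∅
  | I m0 x => insert x (dom m0)
  | L m0 _ _ _ => dom m0

theorem mem_dom {m : Fmap} {z : ℕ} : z ∈ dom m ↔ exd m z := by
  induction m with
  | V => simp [dom, exd]
  | I m0 x ih => simp [dom, exd, ih]
  | L m0 k x y ih => simp [dom, exd, ih]

theorem per_P {m : Fmap} (h : inv_hmap m) (k : Dim) : Per (P m h k) :=
  per_of_fin _ (dom m) (fun z hz => by
    rw [mem_dom] at *; rw [P_in h k hz]; exact cA_exd h k hz)
    (fun z hz => P_out h k (fun e => hz (mem_dom.2 e)))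

theorem per_Pf {m : Fmap} (h : inv_hmap m) : Per (Pf m h) :=
  per_of_fin _ (dom m) (fun z hz => by
    rw [mem_dom] at *; rw [Pf_in h hz]; exact cF_exd h hz)
    (fun z hz => Pf_out h (fun e => hz (mem_dom.2 e)))

theorem iter_eq {σ : Perm ℕ} {f : ℕ → ℕ} {E : ℕ → Prop} (h1 : ∀ z, E z → σ z = f z)
    (h2 : ∀ z, E z → E (f z)) (n : ℕ) {z : ℕ} (hz : E z) : (σ ^ n) z = f^[n] z ∧ E (f^[n] z) := by
  induction n with
  | zero => exact ⟨by simp, hz⟩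
  | succ n ih =>
    rw [pow_succ', Perm.mul_apply, ih.1, Function.iterate_succ_apply', h1 _ ih.2]
    exact ⟨rfl, h2 _ ih.2⟩

theorem expf_iff {m : Fmap} (h : inv_hmap m) {z t : ℕ} :
    expf m z t ↔ exd m z ∧ SameCycle (Pf m h) z t := by
  unfold expf
  refine and_congr_right fun hz => ?_
  rw [same_nat (per_Pf h)]
  refine exists_congr fun n => ?_
  rw [(iter_eq (fun z hz => Pf_in h hz) (fun z hz => cF_exd h hz) n hz).1]

theorem expe_iff {m : Fmap} (h : inv_hmap m) {z t : ℕ} :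
    expe m z t ↔ exd m z ∧ SameCycle (P m h Dim.zero) z t := by
  unfold expe
  refine and_congr_right fun hz => ?_
  rw [same_nat (per_P h _)]
  refine exists_congr fun n => ?_
  rw [(iter_eq (fun z hz => P_in h Dim.zero hz) (fun z hz => cA_exd h Dim.zero hz) n hz).1]

theorem P_I {m : Fmap} {x : ℕ} (h : inv_hmap (I m x)) (k : Dim) : P (I m x) h k = P m h.1 k := by
  ext z
  by_cases hx : z = x
  · subst hx
    rw [P_in h k (Or.inl rfl), P_out h.1 k h.2.2]; simp [cA]
  · by_cases hz : exd m z
    · rw [P_in h k (Or.inr hz), P_in h.1 k hz]; simp [cA, hx]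
    · rw [P_out h.1 k hz, P_out h k]
      rintro (e | e)
      exacts [hx e, hz e]

theorem P_L_ne {m : Fmap} {k0 k : Dim} {x y : ℕ} (h : inv_hmap (L m k0 x y)) (hk : k ≠ k0) :
    P (L m k0 x y) h k = P m h.1 k := by
  ext z
  by_cases hz : exd m z
  · rw [P_in h k hz, P_in h.1 k hz]; simp [cA, hk]
  · rw [P_out h.1 k hz, P_out h k hz]

theorem cA_top {m : Fmap} (h : inv_hmap m) {k : Dim} {y : ℕ} (hy : exd m y) (hp : ¬ predd m k y) :
    cA m k (top m k y) = y := by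
  have s := spec h k hy
  rw [(spec h k s.te).ca, if_pos (not_not.1 s.ts)]
  exact bottom_of_RT h s.te s.tr hp

theorem P_L_eq {m : Fmap} {k : Dim} {x y : ℕ} (h : inv_hmap (L m k x y)) :
    P (L m k x y) h k = P m h.1 k * swap x (top m k y) := by
  have sy := spec h.1 k h.2.2.1
  have sx := spec h.1 k h.2.1
  ext z
  rw [Perm.mul_apply]
  by_cases hz : exd m z
  · rw [P_in h k hz]
    simp only [cA, if_true]
    split_ifs with e1 e2
    · rw [e1, swap_apply_left, P_in h.1 k sy.te, cA_top h.1 h.2.2.1 h.2.2.2.2.1]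
    · rw [e2, swap_apply_right, P_in h.1 k h.2.1, sx.ca, if_pos (not_not.1 h.2.2.2.1)]
    · rw [swap_apply_of_ne_of_ne e1 e2, P_in h.1 k hz]
  · rw [swap_apply_of_ne_of_ne, P_out h.1 k hz, P_out h k hz]
    · exact fun e => hz (e ▸ h.2.1)
    · exact fun e => hz (e ▸ sy.te)

theorem L_x_ne {m : Fmap} {k : Dim} {x y : ℕ} (h : inv_hmap (L m k x y)) : x ≠ top m k y := by
  intro e
  have := cA_top h.1 h.2.2.1 h.2.2.2.2.1
  rw [← e] at this
  exact h.2.2.2.2.2 this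

theorem Pi_top {m : Fmap} {k : Dim} {x y : ℕ} (h : inv_hmap (L m k x y)) :
    (P m h.1 k)⁻¹ y = top m k y := by
  rw [Perm.inv_eq_iff_eq, P_in h.1 k (spec h.1 k h.2.2.1).te, cA_top h.1 h.2.2.1 h.2.2.2.2.1]

theorem swap_conj (f : Perm ℕ) (a b : ℕ) : f * swap a b = swap (f a) (f b) * f := by
  ext z
  simp only [Perm.mul_apply]
  rw [Function.Injective.swap_apply f.injective]

/-- First swapped dart. -/
noncomputable def sa (m : Fmap) (k : Dim) (x : ℕ) : ℕ :=
  match k with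
  | Dim.zero => cA_1 m Dim.one x
  | Dim.one => x

/-- Second swapped dart. -/
noncomputable def sb (m : Fmap) (k : Dim) (y : ℕ) : ℕ :=
  match k with
  | Dim.zero => cA_1 m Dim.one (top m Dim.zero y)
  | Dim.one => top m Dim.one y

theorem sab {m : Fmap} {k : Dim} {x y : ℕ} (h : inv_hmap (L m k x y)) :
    exd m (sa m k x) ∧ exd m (sb m k y) ∧ sa m k x ≠ sb m k y ∧
    Pf (L m k x y) h = swap (sa m k x) (sb m k y) * Pf m h.1 := by
  have te := (spec h.1 k h.2.2.1).te
  have hne := L_x_ne h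
  cases k with
  | zero =>
    refine ⟨cA_1_exd h.1 _ h.2.1, cA_1_exd h.1 _ te, ?_, ?_⟩
    · simp only [sa, sb]
      rw [← Pi_in h.1 _ h.2.1, ← Pi_in h.1 _ te]
      exact fun e => hne ((P m h.1 Dim.one)⁻¹.injective e)
    · simp only [Pf, sa, sb]
      rw [← Pi_in h.1 _ h.2.1, ← Pi_in h.1 _ te, P_L_eq h, P_L_ne h (by decide), mul_inv_rev, swap_inv,
        ← mul_assoc, swap_conj, mul_assoc]
  | one =>
    refine ⟨h.2.1, te, hne, ?_⟩
    simp only [Pf, sa, sb]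
    rw [P_L_eq h, P_L_ne h (by decide), mul_inv_rev, swap_inv, mul_assoc]

theorem cF_y {m : Fmap} {x y : ℕ} (h : inv_hmap (L m Dim.zero x y)) :
    Pf m h.1 y = sb m Dim.zero y := by
  rw [Pf, Perm.mul_apply, Pi_top h, Pi_in h.1 _ (spec h.1 _ h.2.2.1).te, sb]

theorem nf_L {m : Fmap} {k : Dim} {x y : ℕ} (h : inv_hmap (L m k x y)) :
    nf (L m k x y) = if SameCycle (Pf m h.1) (sa m k x) (sb m k y) then nf m + 1 else nf m - 1 := by
  have te := (spec h.1 k h.2.2.1).te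
  cases k with
  | zero =>
    have : expf m (cA_1 m Dim.one x) y ↔ SameCycle (Pf m h.1) (sa m Dim.zero x) (sb m Dim.zero y) := by
      rw [expf_iff h.1, ← cF_y h, sameCycle_apply_right]
      simp [sa, cA_1_exd h.1 _ h.2.1]
    simp only [nf, this]
  | one =>
    have : expf m x (cA m Dim.zero y) ↔ SameCycle (Pf m h.1) (sa m Dim.one x) (sb m Dim.one y) := by
      have e : Pf m h.1 (cA m Dim.zero y) = sb m Dim.one y := by
        rw [Pf, Perm.mul_apply, Pi_in h.1 _ (cA_exd h.1 _ h.2.2.1), cA_1_cA h.1 _ h.2.2.1, Pi_top h, sb]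
      rw [expf_iff h.1, ← e, sameCycle_apply_right]
      simp only [sa, and_iff_right_iff_imp]
      exact fun _ => h.2.1
    simp only [nf, this]

theorem nf_cnt {m : Fmap} (h : inv_hmap m) : nf m = cnt (SameCycle (Pf m h)) (dom m) := by
  induction m with
  | V => simp [nf, cnt, dom]
  | I m0 x ih =>
    have e : Pf (I m0 x) h = Pf m0 h.1 := by rw [Pf, Pf, P_I, P_I]
    have hx : Pf m0 h.1 x = x := Pf_out h.1 h.2.2
    have hxs : ∀ z, SameCycle (Pf m0 h.1) x z → x = z := by
      intro z hs
      obtain ⟨n, hn⟩ := (same_nat (per_Pf h.1)).1 hs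
      rw [← hn]
      clear hn
      induction n with
      | zero => simp
      | succ n ih => rw [pow_succ, Perm.mul_apply, hx, ← ih]
    rw [e, nf, ih h.1, dom]
    have hxd : x ∉ dom m0 := fun hd => h.2.2 (mem_dom.1 hd)
    refine (cnt_insert hxd (fun _ _ _ _ => Iff.rfl) ?_ ?_).symm
    · intro z hz hs
      exact hxd ((hxs z hs.symm) ▸ hz)
    · intro z hz hs
      exact hxd ((hxs z hs) ▸ hz)
  | L m0 k x y ih =>
    obtain ⟨ha, hb, hab, e⟩ := sab h
    rw [nf_L h, ih h.1]
    exact (cnt_perm (per_Pf h.1) (per_Pf h) e (mem_dom.2 ha) (mem_dom.2 hb) hab).symm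

theorem eqc_exd {m : Fmap} {z t : ℕ} (hc : eqc m z t) : exd m z ∧ exd m t := by
  induction m generalizing z t with
  | V => exact absurd hc id
  | I m0 x ih =>
    rcases hc with ⟨h1, h2⟩ | hc
    · exact ⟨Or.inl h1, Or.inl h2⟩
    · exact ⟨Or.inr (ih hc).1, Or.inr (ih hc).2⟩
  | L m0 k x y ih =>
    rcases hc with hc | ⟨h1, h2⟩ | ⟨h1, h2⟩
    · exact ih hc
    · exact ⟨(ih h1).1, (ih h2).2⟩
    · exact ⟨(ih h1).1, (ih h2).2⟩

/-- Elementary adjacency. -/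
def Lk (m : Fmap) (u v : ℕ) : Prop := ∃ k, R m k u v

theorem eqvGen_pair {r r' : ℕ → ℕ → Prop} {x y : ℕ}
    (h : ∀ u v, r' u v ↔ r u v ∨ (u = x ∧ v = y)) (z t : ℕ) :
    EqvGen r' z t ↔ Jn (EqvGen r) x y z t := by
  have hm : ∀ u v, EqvGen r u v → EqvGen r' u v := fun u v h' =>
    EqvGen.mono (fun a b hab => (h a b).2 (Or.inl hab)) _ _ h'
  have hxy : EqvGen r' x y := EqvGen.rel _ _ ((h x y).2 (Or.inr ⟨rfl, rfl⟩))
  have hJ := Jn_equiv (EqvGen.is_equivalence r) x y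
  constructor
  · intro hz
    induction hz with
    | rel u v huv =>
      rcases (h u v).1 huv with h1 | ⟨rfl, rfl⟩
      · exact Or.inl (EqvGen.rel _ _ h1)
      · exact Or.inr (Or.inl ⟨EqvGen.refl _, EqvGen.refl _⟩)
    | refl u => exact hJ.refl u
    | symm u v _ ih => exact hJ.symm ih
    | trans u v w _ _ i1 i2 => exact hJ.trans i1 i2
  · rintro (h1 | ⟨h1, h2⟩ | ⟨h1, h2⟩)
    · exact hm _ _ h1
    · exact ((hm _ _ h1).trans _ _ _ hxy).trans _ _ _ (hm _ _ h2)
    · exact ((hm _ _ h1).trans _ _ _ (hxy.symm _ _)).trans _ _ _ (hm _ _ h2)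

theorem Lk_exd {m : Fmap} (h : inv_hmap m) {u v : ℕ} (he : EqvGen (Lk m) u v) :
    exd m u ↔ exd m v := by
  induction he with
  | rel u v huv =>
    obtain ⟨k, hk⟩ := huv
    exact ⟨fun _ => (R_exd h hk).2, fun _ => (R_exd h hk).1⟩
  | refl u => rfl
  | symm u v _ ih => exact ih.symm
  | trans u v w _ _ i1 i2 => exact i1.trans i2

theorem Lk_out {m : Fmap} (h : inv_hmap m) {u v : ℕ} (he : EqvGen (Lk m) u v) :
    exd m u ∨ u = v := by
  induction he with
  | rel u v huv =>
    obtain ⟨k, hk⟩ := huv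
    exact Or.inl (R_exd h hk).1
  | refl u => exact Or.inr rfl
  | symm u v he ih =>
    rcases ih with ih | ih
    · exact Or.inl ((Lk_exd h he).1 ih)
    · exact Or.inr ih.symm
  | trans u v w h1 h2 i1 i2 =>
    rcases i1 with i1 | rfl
    · exact Or.inl i1
    · exact i2

theorem eqc_iff {m : Fmap} (h : inv_hmap m) {z t : ℕ} :
    eqc m z t ↔ exd m z ∧ EqvGen (Lk m) z t := by
  induction m generalizing z t with
  | V => simp [eqc, exd]
  | I m0 x ih =>
    have e : Lk (I m0 x) = Lk m0 := rfl
    rw [e, eqc, ih h.1, exd]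
    constructor
    · rintro (⟨rfl, rfl⟩ | ⟨h1, h2⟩)
      · exact ⟨Or.inl rfl, EqvGen.refl _⟩
      · exact ⟨Or.inr h1, h2⟩
    · rintro ⟨rfl | h1, h2⟩
      · rcases Lk_out h.1 h2 with h3 | h3
        · exact absurd h3 h.2.2
        · exact Or.inl ⟨rfl, h3.symm⟩
      · exact Or.inr ⟨h1, h2⟩
  | L m0 k x y ih =>
    have e : ∀ u v, Lk (L m0 k x y) u v ↔ Lk m0 u v ∨ (u = x ∧ v = y) := by
      intro u v
      unfold Lk
      constructor
      · rintro ⟨k', hk'⟩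
        rcases (R_L h).1 hk' with h1 | ⟨_, h1⟩
        · exact Or.inl ⟨_, h1⟩
        · exact Or.inr h1
      · rintro (⟨k', h1⟩ | h1)
        · exact ⟨k', (R_L h).2 (Or.inl h1)⟩
        · exact ⟨k, (R_L h).2 (Or.inr ⟨rfl, h1⟩)⟩
    have hx : exd m0 x := h.2.1
    have hy : exd m0 y := h.2.2.1
    rw [eqvGen_pair e, eqc, ih h.1, ih h.1, ih h.1, ih h.1, ih h.1, exd]
    unfold Jn
    tauto

theorem eqc_eqOn {m : Fmap} (h : inv_hmap m) : EqOn (eqc m) (dom m) := by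
  refine ⟨fun z hz => (eqc_iff h).2 ⟨mem_dom.1 hz, EqvGen.refl _⟩, ?_, ?_⟩
  · intro z t hc
    rw [eqc_iff h] at *
    exact ⟨(Lk_exd h hc.2).1 hc.1, hc.2.symm _ _⟩
  · intro z t u h1 h2
    rw [eqc_iff h] at *
    exact ⟨h1.1, h1.2.trans _ _ _ h2.2⟩

theorem nc_cnt {m : Fmap} (h : inv_hmap m) : nc m = cnt (eqc m) (dom m) := by
  induction m with
  | V => simp [nc, cnt, dom]
  | I m0 x ih =>
    have hxd : x ∉ dom m0 := fun hd => h.2.2 (mem_dom.1 hd)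
    rw [nc, ih h.1, dom]
    refine (cnt_insert hxd ?_ ?_ ?_).symm
    · intro z hz t ht
      simp only [eqc, or_iff_right_iff_imp]
      rintro ⟨rfl, _⟩
      exact absurd hz hxd
    · rintro z hz (⟨rfl, _⟩ | hc)
      · exact hxd hz
      · exact h.2.2 (eqc_exd hc).2
    · rintro z hz (⟨_, rfl⟩ | hc)
      · exact hxd hz
      · exact h.2.2 (eqc_exd hc).1
  | L m0 k x y ih =>
    have hE := eqc_eqOn h.1
    rw [nc, ih h.1, dom]
    split_ifs with hc
    · apply cnt_congr
      intro z hz t ht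
      simp only [eqc]
      constructor
      · exact Or.inl
      · rintro (h1 | ⟨h1, h2⟩ | ⟨h1, h2⟩)
        · exact h1
        · exact hE.trans _ _ _ h1 (hE.trans _ _ _ hc h2)
        · exact hE.trans _ _ _ h1 (hE.trans _ _ _ (hE.symm _ _ hc) h2)
    · exact (cnt_merge hE (mem_dom.2 h.2.1) (mem_dom.2 h.2.2.1) hc (fun _ _ _ _ => Iff.rfl)).symm

theorem Sim.dom {m m' : Fmap} (s : Sim m m') : dom m = dom m' := by
  ext z; rw [mem_dom, mem_dom, s.e]

theorem Sim.nc {m m' : Fmap} (h : inv_hmap m) (h' : inv_hmap m') (s : Sim m m') : nc m = nc m' := by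
  rw [nc_cnt h, nc_cnt h', s.dom]
  apply cnt_congr
  intro z _ t _
  rw [eqc_iff h, eqc_iff h', s.e]
  have : Lk m = Lk m' := by funext u v; unfold Lk; simp only [s.R]
  rw [this]

theorem Sim.P {m m' : Fmap} (h : inv_hmap m) (h' : inv_hmap m') (s : Sim m m') (k : Dim) :
    P m h k = P m' h' k := by
  ext z
  by_cases hz : exd m z
  · rw [P_in h k hz, P_in h' k ((s.e z).1 hz), (s.all h h' k z).2.2.1]
  · rw [P_out h k hz, P_out h' k (fun hh => hz ((s.e z).2 hh))]

theorem Sim.Pf {m m' : Fmap} (h : inv_hmap m) (h' : inv_hmap m') (s : Sim m m') :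
    Pf m h = Pf m' h' := by
  rw [Fmap.Pf, Fmap.Pf, s.P h h', s.P h h']

theorem Sim.nf {m m' : Fmap} (h : inv_hmap m) (h' : inv_hmap m') (s : Sim m m') : nf m = nf m' := by
  rw [nf_cnt h, nf_cnt h', s.dom, s.Pf h h']

end Fmap

namespace Fmap
open Equiv Equiv.Perm Relation

theorem RT_Lk {m : Fmap} {k : Dim} {u v : ℕ} (h : RT m k u v) : EqvGen (Lk m) u v := by
  induction h with
  | refl => exact EqvGen.refl _
  | tail _ h2 ih => exact ih.trans _ _ _ (EqvGen.rel _ _ ⟨k, h2⟩)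

theorem cA_1_Lk {m : Fmap} (h : inv_hmap m) (k : Dim) {z : ℕ} (hz : exd m z) :
    EqvGen (Lk m) z (cA_1 m k z) := by
  have s := spec h k hz
  rw [s.ca']
  split_ifs with e
  · exact RT_Lk s.tr
  · exact (EqvGen.rel _ _ ⟨k, (R_iff_pred h).2 ⟨rfl, e⟩⟩ : EqvGen (Lk m) _ _).symm _ _

theorem Pf_Lk {m : Fmap} (h : inv_hmap m) {z t : ℕ} (hs : SameCycle (Pf m h) z t) :
    EqvGen (Lk m) z t := by
  refine same_of_step (per_Pf h) (EqvGen.is_equivalence _) ?_ hs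
  intro z
  by_cases hz : exd m z
  · rw [Pf_in h hz, cF]
    exact (cA_1_Lk h _ hz).trans _ _ _ (cA_1_Lk h _ (cA_1_exd h _ hz))
  · rw [Pf_out h hz]; exact EqvGen.refl _

theorem same_eqc {m : Fmap} {k : Dim} {x y : ℕ} (h : inv_hmap (L m k x y))
    (hs : SameCycle (Pf m h.1) (sa m k x) (sb m k y)) : eqc m x y := by
  rw [eqc_iff h.1]
  refine ⟨h.2.1, ?_⟩
  have h0 := Pf_Lk h.1 hs
  have sy := spec h.1 k h.2.2.1
  have ht := RT_Lk sy.tr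
  cases k with
  | zero =>
    exact (((cA_1_Lk h.1 Dim.one h.2.1).trans _ _ _ h0).trans _ _ _
      ((cA_1_Lk h.1 Dim.one sy.te).symm _ _)).trans _ _ _ (ht.symm _ _)
  | one => exact h0.trans _ _ _ (ht.symm _ _)

theorem ec_L {m : Fmap} {k : Dim} {x y : ℕ} (h : inv_hmap (L m k x y)) :
    ec (L m k x y) = if SameCycle (Pf m h.1) (sa m k x) (sb m k y) then ec m else ec m - 2 := by
  unfold ec
  rw [nf_L h]
  cases k <;> simp only [nv, ne, nd] <;> split_ifs <;> omega

theorem q_L {m : Fmap} {k : Dim} {x y : ℕ} (h : inv_hmap (L m k x y)) :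
    (¬ eqc m x y → ¬ SameCycle (Pf m h.1) (sa m k x) (sb m k y)) ∧
    2 * nc (L m k x y) - ec (L m k x y) = 2 * nc m - ec m +
      if eqc m x y ∧ ¬ SameCycle (Pf m h.1) (sa m k x) (sb m k y) then 2 else 0 := by
  have h1 : ¬ eqc m x y → ¬ SameCycle (Pf m h.1) (sa m k x) (sb m k y) :=
    fun hn hs => hn (same_eqc h hs)
  refine ⟨h1, ?_⟩
  rw [ec_L h, nc]
  by_cases hc : eqc m x y <;> by_cases hs : SameCycle (Pf m h.1) (sa m k x) (sb m k y)
  · simp [hc, hs]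
  · simp [hc, hs]; omega
  · exact absurd hs (h1 hc)
  · simp [hc, hs]; omega

theorem q_nonneg {m : Fmap} (h : inv_hmap m) : 0 ≤ 2 * nc m - ec m ∧ 2 ∣ ec m := by
  induction m with
  | V => simp [nc, ec, nv, ne, nf, nd]
  | I m0 x ih =>
    have := ih h.1
    simp only [nc, ec, nv, ne, nf, nd] at *
    omega
  | L m0 k x y ih =>
    have i := ih h.1
    have q := (q_L h).2
    have e := ec_L h
    constructor
    · rw [q]; split_ifs <;> omega
    · rw [e]; split_ifs <;> omega

theorem planar_iff {m : Fmap} (h : inv_hmap m) : planar m ↔ 2 * nc m - ec m = 0 := by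
  have := (q_nonneg h).2
  unfold planar genus
  omega

theorem exd_B {m : Fmap} {k : Dim} {x z : ℕ} : exd (B m k x) z ↔ exd m z := by
  induction m with
  | V => rfl
  | I m0 x0 ih => simp only [B, exd, ih]
  | L m0 k0 x0 y0 ih =>
    simp only [B]
    split_ifs
    · rfl
    · exact ih

theorem A_B {m : Fmap} (h : inv_hmap m) {k k' : Dim} {x z : ℕ} :
    A (B m k x) k' z = if k' = k ∧ z = x then nil else A m k' z := by
  induction m with
  | V => simp [B, A]
  | I m0 x0 ih => simp only [B, A]; exact ih h.1
  | L m0 k0 x0 y0 ih =>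
    have i := ih h.1
    simp only [B]
    by_cases e : k = k0 ∧ x = x0
    · obtain ⟨rfl, rfl⟩ := e
      have hs : A m0 k x = nil := not_not.1 h.2.2.2.1
      rw [if_pos ⟨rfl, rfl⟩]
      simp only [A]
      by_cases e1 : k' = k
      · subst e1
        by_cases e2 : z = x
        · subst e2; simp [hs]
        · simp [e2]
      · simp [e1]
    · rw [if_neg e]
      simp only [A, i]
      by_cases e1 : k' = k0
      · by_cases e2 : z = x0
        · have : ¬ (k' = k ∧ z = x) := by
            rintro ⟨f1, f2⟩; exact e ⟨f1 ▸ e1, f2 ▸ e2⟩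
          simp [e1, e2]
          intro f1 f2; exact absurd ⟨f1.symm, f2.symm⟩ e
        · simp [e2]
      · simp [e1]

theorem R_B {m : Fmap} (h : inv_hmap m) {k k' : Dim} {x u v : ℕ} :
    R (B m k x) k' u v ↔ R m k' u v ∧ ¬ (k' = k ∧ u = x) := by
  unfold R
  rw [A_B h]
  split_ifs with e
  · constructor
    · rintro ⟨h1, h2⟩; exact absurd h1.symm h2
    · rintro ⟨_, h2⟩; exact absurd e h2
  · simp [e]

theorem inv_B {m : Fmap} (h : inv_hmap m) (k : Dim) (x : ℕ) : inv_hmap (B m k x) := by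
  induction m with
  | V => trivial
  | I m0 x0 ih => exact ⟨ih h.1, h.2.1, fun e => h.2.2 (exd_B.1 e)⟩
  | L m0 k0 x0 y0 ih =>
    have i := ih h.1
    simp only [B]
    split_ifs
    · exact h.1
    · have hs : ¬ succd (B m0 k x) k0 x0 := by
        rw [succd_iff]
        rintro ⟨v, hv⟩
        exact h.2.2.2.1 (succd_iff.2 ⟨v, ((R_B h.1).1 hv).1⟩)
      refine ⟨i, exd_B.2 h.2.1, exd_B.2 h.2.2.1, hs, ?_, ?_⟩
      · rw [predd_iff i]
        rintro ⟨v, hv⟩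
        exact h.2.2.2.2.1 ((predd_iff h.1).2 ⟨v, ((R_B h.1).1 hv).1⟩)
      · have s := spec i k0 (exd_B.2 h.2.1)
        rw [s.ca, if_pos (not_not.1 hs)]
        intro e
        have hr := s.br
        rw [e] at hr
        have hr' : RT m0 k0 y0 x0 := RT_mono (fun u v huv => ((R_B h.1).1 huv).1) hr
        apply h.2.2.2.2.2
        rw [(spec h.1 k0 h.2.1).ca, if_pos (not_not.1 h.2.2.2.1)]
        exact bottom_of_RT h.1 h.2.1 hr' h.2.2.2.2.1

theorem acyc {m : Fmap} (h : inv_hmap m) {k : Dim} {x y : ℕ} (hr : R m k x y) : ¬ RT m k y x := by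
  intro hc
  have key : ∀ w, RT m k x w → RT m k w x := by
    intro w hw
    induction hw with
    | refl => exact ReflTransGen.refl
    | @tail w w' _ h2 ih =>
      rcases ReflTransGen.cases_head ih with e | ⟨c, h3, h4⟩
      · subst e
        rw [R_fun h2 hr]; exact hc
      · rw [R_fun h2 h3]; exact h4
  have s := spec h k (R_exd h hr).1
  apply s.ts
  rcases ReflTransGen.cases_head (key _ s.tr) with e | ⟨c, h3, h4⟩
  · rw [e]; exact succd_iff.2 ⟨y, hr⟩
  · exact succd_iff.2 ⟨c, h3⟩

theorem inv_LB {m : Fmap} (h : inv_hmap m) {k : Dim} {x : ℕ} (hs : succd m k x) :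
    inv_hmap (L (B m k x) k x (A m k x)) := by
  have hr : R m k x (A m k x) := ⟨rfl, hs⟩
  have i := inv_B h k x
  have hns : ¬ succd (B m k x) k x := by
    unfold succd; rw [A_B h]; simp
  refine ⟨i, exd_B.2 (R_exd h hr).1, exd_B.2 (R_exd h hr).2, hns, ?_, ?_⟩
  · rw [predd_iff i]
    rintro ⟨u, hu⟩
    have := (R_B h).1 hu
    exact this.2 ⟨rfl, R_inj h this.1 hr⟩
  · have s := spec i k (exd_B.2 (R_exd h hr).1)
    rw [s.ca, if_pos (not_not.1 hns)]
    intro e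
    have hb := s.br
    rw [e] at hb
    exact acyc h hr (RT_mono (fun u v huv => ((R_B h).1 huv).1) hb)

theorem sim_LB {m : Fmap} (h : inv_hmap m) {k : Dim} {x : ℕ} :
    Sim m (L (B m k x) k x (A m k x)) := by
  refine ⟨fun z => exd_B.symm, ?_⟩
  intro k' z
  simp only [A, A_B h]
  by_cases e1 : k' = k
  · subst e1
    by_cases e2 : z = x
    · simp [e2]
    · simp [e2]
  · simp [e1]

theorem counts_B {m : Fmap} (h : inv_hmap m) {x : ℕ} (hs : succd m Dim.zero x) :
    nv (B m Dim.zero x) = nv m ∧ ne (B m Dim.zero x) = ne m + 1 ∧ nd (B m Dim.zero x) = nd m := by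
  induction m with
  | V => exact absurd rfl hs
  | I m0 x0 ih =>
    have := ih h.1 hs
    simp only [B, nv, ne, nd]; omega
  | L m0 k0 x0 y0 ih =>
    simp only [B]
    by_cases e : Dim.zero = k0 ∧ x = x0
    · rw [if_pos e]
      obtain ⟨rfl, rfl⟩ := e
      simp [nv, ne, nd]
    · rw [if_neg e]
      have hs' : succd m0 Dim.zero x := by
        obtain ⟨v, hv⟩ := succd_iff.1 hs
        rcases (R_L h).1 hv with h1 | ⟨h1, h2, _⟩
        · exact succd_iff.2 ⟨v, h1⟩
        · exact absurd ⟨h1, h2⟩ e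
      have := ih h.1 hs'
      cases k0 <;> simp only [nv, ne, nd] <;> omega

theorem ec_LB {m : Fmap} (h : inv_hmap m) {x : ℕ} (hs : succd m Dim.zero x) :
    ec (L (B m Dim.zero x) Dim.zero x (A m Dim.zero x)) = ec m := by
  have c := counts_B h hs
  unfold ec
  rw [← (sim_LB h).nf h (inv_LB h hs)]
  simp only [nv, ne, nd]
  omega

theorem expf_exd {m : Fmap} (h : inv_hmap m) {z t : ℕ} (he : expf m z t) : exd m t := by
  obtain ⟨hz, n, hn⟩ := he
  rw [← hn]
  exact (iter_eq (fun z hz => Pf_in h hz) (fun z hz => cF_exd h hz) n hz).2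

theorem expf_symm {m : Fmap} (h : inv_hmap m) {z t : ℕ} (he : expf m z t) : expf m t z := by
  have := expf_exd h he
  rw [expf_iff h] at *
  exact ⟨this, he.2.symm⟩

theorem expf_trans {m : Fmap} (h : inv_hmap m) {z t u : ℕ} (he : expf m z t) (h2 : expf m t u) :
    expf m z u := by
  rw [expf_iff h] at *
  exact ⟨he.1, he.2.trans h2.2⟩

/-- All facts on a single break. -/
structure Brk (m : Fmap) (x : ℕ) : Prop where
  inv : inv_hmap (B m Dim.zero x)
  ey : exd m (A m Dim.zero x)
  eb : exd m (bottom m Dim.zero x)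
  pl : planar m → planar (B m Dim.zero x)
  ncT : planar m → expf m (A m Dim.zero x) (bottom m Dim.zero x) → nc (B m Dim.zero x) = nc m + 1
  ncF : planar m → ¬ expf m (A m Dim.zero x) (bottom m Dim.zero x) → nc (B m Dim.zero x) = nc m
  join : ¬ expf m (A m Dim.zero x) (bottom m Dim.zero x) → ∀ z t,
    (expf (B m Dim.zero x) z t ↔ Jn (expf m) (A m Dim.zero x) (bottom m Dim.zero x) z t)

theorem brk {m : Fmap} (h : inv_hmap m) {x : ℕ} (hs : succd m Dim.zero x) : Brk m x := by
  have hL := inv_LB h hs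
  have sim := sim_LB h (k := Dim.zero) (x := x)
  have hnc := sim.nc h hL
  have hec := ec_LB h hs
  have hPf := sim.Pf h hL
  have hr : R m Dim.zero x (A m Dim.zero x) := ⟨rfl, hs⟩
  have ex := (R_exd h hr).1
  have ey := (R_exd h hr).2
  have sx := spec h Dim.zero ex
  have hbot := (sim.all h hL Dim.zero x).1
  obtain ⟨ha, hb, hab, hPL⟩ := sab hL
  have q := q_L hL
  have hy := cF_y hL
  have q1 := q_nonneg hL.1
  have sx1 := spec hL.1 Dim.zero hL.2.1
  have hcA1 : cA (B m Dim.zero x) Dim.zero x = bottom (B m Dim.zero x) Dim.zero x := by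
    rw [sx1.ca, if_pos (not_not.1 hL.2.2.2.1)]
  have hbne := hL.2.2.2.2.2
  rw [hcA1] at hbne
  have hbot1 : bottom m Dim.zero x = bottom (B m Dim.zero x) Dim.zero x := by
    rw [hbot]; simp only [bottom, if_true]; rw [if_neg hbne]
  set y := A m Dim.zero x with hydef
  set x0 := bottom m Dim.zero x with hx0
  set m1 := B m Dim.zero x with hm1
  set a := sa m1 Dim.zero x with hadef
  set b := sb m1 Dim.zero y with hbdef
  have hPx0 : Pf m1 hL.1 x0 = a := by
    rw [Pf, Perm.mul_apply, hbot1, ← hcA1, Pi_in hL.1 _ (cA_exd hL.1 _ hL.2.1),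
      cA_1_cA hL.1 _ hL.2.1, Pi_in hL.1 _ hL.2.1]
    rfl
  have eP : Pf m h = swap a b * Pf m1 hL.1 := hPf.trans hPL
  have eP' : Pf m1 hL.1 = swap a b * Pf m h := by rw [eP, ← mul_assoc, swap_mul_self, one_mul]
  have my : Pf m h y = a := by rw [eP, Perm.mul_apply, hy, swap_apply_right]
  have mx0 : Pf m h x0 = b := by rw [eP, Perm.mul_apply, hPx0, swap_apply_left]
  have hyx : expf m y x0 ↔ SameCycle (Pf m h) a b := by
    rw [expf_iff h, ← my, ← mx0, sameCycle_apply_left, sameCycle_apply_right]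
    exact and_iff_right ey
  have hiff : SameCycle (Pf m h) a b ↔ ¬ SameCycle (Pf m1 hL.1) a b := by
    constructor
    · intro hh
      rw [eP']
      exact split_not_same (per_Pf h) (eP' ▸ per_Pf hL.1) hab hh
    · intro hh
      rw [eP]
      exact merge_same_ab (per_Pf hL.1) hh
  have hnc' : nc (L m1 Dim.zero x y) = if eqc m1 x y then nc m1 else nc m1 - 1 := rfl
  obtain ⟨q2, q3⟩ := q
  rw [← hnc, hec] at q3
  rw [← hnc] at hnc'
  refine ⟨hL.1, ey, sx.be, ?_, ?_, ?_, ?_⟩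
  · rw [planar_iff h, planar_iff hL.1]
    intro hp
    change 2 * nc m1 - ec m1 = 0
    change 0 ≤ 2 * nc m1 - ec m1 ∧ _ at q1
    have q4 := q1.1
    clear hnc' hnc hec hab
    split_ifs at q3 <;> linarith
  · rw [planar_iff h]
    intro hp he
    have hns := hiff.1 (hyx.1 he)
    change nc m1 = nc m + 1
    have q4 : 0 ≤ 2 * nc m1 - ec m1 := q1.1
    by_cases hc : eqc m1 x y
    · rw [if_pos ⟨hc, hns⟩] at q3; linarith
    · rw [if_neg hc] at hnc'; linarith
  · rw [planar_iff h]
    intro hp he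
    have hns : SameCycle (Pf m1 hL.1) a b := by
      by_contra hh; exact he (hyx.2 (hiff.2 hh))
    have hc : eqc m1 x y := by
      by_contra hh; exact q2 hh hns
    rw [if_pos hc] at hnc'; exact hnc'.symm
  · intro he z t
    have hns : ¬ SameCycle (Pf m h) a b := fun hh => he (hyx.2 hh)
    have key : SameCycle (Pf m1 hL.1) z t ↔ Jn (SameCycle (Pf m h)) a b z t := by
      conv_lhs => rw [eP']
      exact merge_iff (per_Pf h) (eP' ▸ per_Pf hL.1) hns z t
    have ez : exd m1 z ↔ exd m z := exd_B
    rw [expf_iff hL.1, key, ez]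
    unfold Jn
    rw [← my, ← mx0]
    simp only [sameCycle_apply_left, sameCycle_apply_right, expf_iff h]
    have := sx.be
    tauto

theorem RT_same {m : Fmap} (h : inv_hmap m) {k : Dim} {u v : ℕ} (hr : RT m k u v) :
    SameCycle (P m h k) u v := by
  induction hr with
  | refl => exact SameCycle.refl _ _
  | @tail w w' _ h2 ih =>
    refine ih.trans ⟨1, ?_⟩
    have e := (R_exd h h2).1
    rw [zpow_one, P_in h k e, (spec h k e).ca, h2.1, if_neg h2.2]

theorem expe_B {m : Fmap} (h : inv_hmap m) {x z t : ℕ} (he : expe (B m Dim.zero x) z t) :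
    expe m z t := by
  have i := inv_B h Dim.zero x
  rw [expe_iff i] at he
  rw [expe_iff h]
  refine ⟨exd_B.1 he.1, ?_⟩
  refine same_of_step (per_P i _) (same_equiv _) ?_ he.2
  intro w
  have hm : ∀ u v, R (B m Dim.zero x) Dim.zero u v → R m Dim.zero u v :=
    fun u v huv => ((R_B h).1 huv).1
  by_cases hw : exd (B m Dim.zero x) w
  · have s := spec i Dim.zero hw
    rw [P_in i _ hw, s.ca]
    split_ifs with e
    · exact (RT_same h (RT_mono hm s.br)).symm
    · exact RT_same h (ReflTransGen.single (hm _ _ ⟨rfl, e⟩))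
  · rw [P_out i _ hw]

theorem bottom_B {m : Fmap} (h : inv_hmap m) {x z : ℕ} (hs : succd m Dim.zero x) (hz : exd m z)
    (he : ¬ expe m x z) : bottom (B m Dim.zero x) Dim.zero z = bottom m Dim.zero z := by
  have hL := inv_LB h hs
  have sim := sim_LB h (k := Dim.zero) (x := x)
  have hr : R m Dim.zero x (A m Dim.zero x) := ⟨rfl, hs⟩
  rw [(sim.all h hL Dim.zero z).1]
  simp only [bottom, if_true]
  rw [if_neg]
  intro e
  apply he
  rw [expe_iff h]
  refine ⟨(R_exd h hr).1, RT_same h (ReflTransGen.head hr ?_)⟩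
  rw [← e]
  exact RT_mono (fun u v huv => ((R_B h).1 huv).1) (spec hL.1 Dim.zero (exd_B.2 hz)).br

/-- The dart on the other side. -/
noncomputable def ot (m : Fmap) (p : ℕ × Bool) : ℕ :=
  if p.2 then bottom m Dim.zero p.1 else A m Dim.zero p.1

theorem adj_iff {m : Fmap} (p q : ℕ × Bool) :
    adjacent_faces m p q ↔ expf m (ot m p) (faceDart m q) := by
  obtain ⟨x, b⟩ := p
  obtain ⟨x', b'⟩ := q
  cases b <;> cases b' <;> simp [adjacent_faces, ot, faceDart]

theorem del_iff {m : Fmap} {x : ℕ} {l : List (ℕ × Bool)} :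
    distinct_edge_list m x l ↔ ∀ p ∈ l, ¬ expe m x p.1 := by
  induction l with
  | nil => simp [distinct_edge_list]
  | cons p l ih =>
    obtain ⟨x', b'⟩ := p
    simp only [distinct_edge_list, ih, List.forall_mem_cons]
    tauto

theorem dfl_iff {m : Fmap} {q : ℕ × Bool} {l : List (ℕ × Bool)} :
    distinct_face_list m q l ↔ ∀ p ∈ l, ¬ expf m (faceDart m q) (faceDart m p) := by
  induction l with
  | nil => simp [distinct_face_list]
  | cons p l ih =>
    simp only [distinct_face_list, ih, List.forall_mem_cons, distinct_faces]
    tauto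

theorem pr0_succ {m : Fmap} {l : List (ℕ × Bool)} (h : pre_ring0 m l) :
    ∀ p ∈ l, succd m Dim.zero p.1 := by
  induction l with
  | nil => simp
  | cons p l ih =>
    obtain ⟨x', b'⟩ := p
    rw [List.forall_mem_cons]
    exact ⟨h.2.2, ih h.1⟩

theorem lastd_mem {l : List (ℕ × Bool)} (h : l ≠ []) : lastd l ∈ l := by
  induction l with
  | nil => exact absurd rfl h
  | cons p l ih =>
    cases l with
    | nil => simp [lastd]
    | cons q l => exact List.mem_cons_of_mem _ (ih (by simp))

theorem ring_step {m : Fmap} (h : inv_hmap m) {x : ℕ} {b : Bool} {p : ℕ × Bool}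
    {l : List (ℕ × Bool)} (hr : ring m ((x, b) :: p :: l)) :
    ¬ expf m (A m Dim.zero x) (bottom m Dim.zero x) ∧ ring (B m Dim.zero x) (p :: l) := by
  obtain ⟨_, h0, h1, h2, h3⟩ := hr
  obtain ⟨h0a, h0b, hs⟩ := h0
  obtain ⟨h1a, h1b⟩ := h1
  obtain ⟨h3a, h3b⟩ := h3
  have K := brk h hs
  rw [del_iff] at h0b
  rw [dfl_iff] at h3b
  change adjacent_faces m (x, b) p at h1b
  change adjacent_faces m (lastd (p :: l)) (x, b) at h2
  rw [adj_iff] at h1b h2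
  have hsl := pr0_succ h0a
  have hexd : ∀ q ∈ p :: l, exd m q.1 := fun q hq =>
    (R_exd h (⟨rfl, hsl q hq⟩ : R m Dim.zero q.1 _)).1
  have hA : ∀ q ∈ p :: l, A (B m Dim.zero x) Dim.zero q.1 = A m Dim.zero q.1 := by
    intro q hq
    rw [A_B h, if_neg]
    rintro ⟨_, e⟩
    apply h0b q hq
    rw [e]
    exact ⟨e ▸ hexd q hq, 0, rfl⟩
  have hB : ∀ q ∈ p :: l, bottom (B m Dim.zero x) Dim.zero q.1 = bottom m Dim.zero q.1 :=
    fun q hq => bottom_B h hs (hexd q hq) (h0b q hq)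
  have hfd : ∀ q ∈ p :: l, faceDart (B m Dim.zero x) q = faceDart m q := by
    intro q hq
    have e1 := hA q hq
    have e2 := hB q hq
    obtain ⟨x', b'⟩ := q
    simp only [faceDart] at *
    rw [e1, e2]
  have hot : ∀ q ∈ p :: l, ot (B m Dim.zero x) q = ot m q := by
    intro q hq
    rw [ot, ot, hA q hq, hB q hq]
  have hne : ¬ expf m (A m Dim.zero x) (bottom m Dim.zero x) := by
    intro he
    apply h3b p (by simp)
    refine expf_trans h ?_ h1b
    cases b
    · simpa [ot, faceDart] using expf_symm h he
    · simpa [ot, faceDart] using he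
  have J := K.join hne
  have hmono : ∀ z t, expf m z t → expf (B m Dim.zero x) z t := fun z t hh => (J z t).2 (Or.inl hh)
  have hyx : expf (B m Dim.zero x) (A m Dim.zero x) (bottom m Dim.zero x) :=
    (J _ _).2 (Or.inr (Or.inl ⟨⟨K.ey, 0, rfl⟩, ⟨K.eb, 0, rfl⟩⟩))
  have hfo : expf (B m Dim.zero x) (faceDart m (x, b)) (ot m (x, b)) := by
    cases b
    · simpa [ot, faceDart] using expf_symm K.inv hyx
    · simpa [ot, faceDart] using hyx
  have hdist : ∀ q ∈ p :: l, ∀ q' ∈ p :: l, ¬ expf m (faceDart m q) (faceDart m q') →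
      ¬ expf (B m Dim.zero x) (faceDart m q) (faceDart m q') := by
    intro q hq q' hq' hn hh
    have n1 := h3b q hq
    have n2 := h3b q' hq'
    rcases (J _ _).1 hh with h5 | ⟨h5, h6⟩ | ⟨h5, h6⟩
    · exact hn h5
    · cases b
      · exact n2 (by simpa [faceDart] using h6)
      · exact n1 (by simpa [faceDart] using expf_symm h h5)
    · cases b
      · exact n1 (by simpa [faceDart] using expf_symm h h5)
      · exact n2 (by simpa [faceDart] using h6)
  refine ⟨hne, by simp, ?_, ?_, ?_, ?_⟩
  · have gen : ∀ l' : List (ℕ × Bool), (∀ q ∈ l', q ∈ p :: l) → pre_ring0 m l' →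
        pre_ring0 (B m Dim.zero x) l' := by
      intro l'
      induction l' with
      | nil => intros; trivial
      | cons q l' ih =>
        obtain ⟨x', b'⟩ := q
        rintro hsub ⟨g1, g2, g3⟩
        rw [List.forall_mem_cons] at hsub
        refine ⟨ih hsub.2 g1, ?_, ?_⟩
        · rw [del_iff] at *
          exact fun r hr he => g2 r hr (expe_B h he)
        · have := hA _ hsub.1
          unfold succd at *
          rw [this]; exact g3
    exact gen _ (fun _ hq => hq) h0a
  · have gen : ∀ l' : List (ℕ × Bool), (∀ q ∈ l', q ∈ p :: l) → pre_ring1 m l' →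
        pre_ring1 (B m Dim.zero x) l' := by
      intro l'
      induction l' with
      | nil => intros; trivial
      | cons q l' ih =>
        rintro hsub ⟨g1, g2⟩
        rw [List.forall_mem_cons] at hsub
        refine ⟨ih hsub.2 g1, ?_⟩
        cases l' with
        | nil => trivial
        | cons r l' =>
          change adjacent_faces m q r at g2
          change adjacent_faces (B m Dim.zero x) q r
          rw [adj_iff] at *
          rw [hot q hsub.1, hfd r (hsub.2 r (by simp))]
          exact hmono _ _ g2
    exact gen _ (fun _ hq => hq) h1a
  · have hlast : expf (B m Dim.zero x) (ot m (lastd (p :: l))) (faceDart m p) :=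
      expf_trans K.inv (hmono _ _ h2) (expf_trans K.inv hfo (hmono _ _ h1b))
    cases l with
    | nil =>
      have e1 := hA p (by simp)
      have e2 := hB p (by simp)
      obtain ⟨x', b'⟩ := p
      change expf (B m Dim.zero x) (A (B m Dim.zero x) Dim.zero x') (bottom (B m Dim.zero x) Dim.zero x')
      simp only at e1 e2
      rw [e1, e2]
      cases b'
      · simpa [lastd, ot, faceDart] using hlast
      · exact expf_symm K.inv (by simpa [lastd, ot, faceDart] using hlast)
    | cons q l =>
      obtain ⟨x', b'⟩ := p
      change adjacent_faces (B m Dim.zero x) (lastd (q :: l)) (x', b')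
      rw [adj_iff, hot _ (List.mem_cons_of_mem _ (lastd_mem (by simp))), hfd _ (by simp)]
      exact hlast
  · have gen : ∀ l' : List (ℕ × Bool), (∀ q ∈ l', q ∈ p :: l) → pre_ring3 m l' →
        pre_ring3 (B m Dim.zero x) l' := by
      intro l'
      induction l' with
      | nil => intros; trivial
      | cons q l' ih =>
        rintro hsub ⟨g1, g2⟩
        rw [List.forall_mem_cons] at hsub
        refine ⟨ih hsub.2 g1, ?_⟩
        rw [dfl_iff] at *
        intro r hr
        rw [hfd q hsub.1, hfd r (hsub.2 r hr)]
        exact hdist q hsub.1 r (hsub.2 r hr) (g2 r hr)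
    exact gen _ (fun _ hq => hq) h3a

end Fmap

open Fmap
/-- Breaking the ring links one at a time keeps the number of components
unchanged until the final break, which disconnects. -/
theorem nc_ring_breaks (m : Fmap) (l : List (Nat × Bool))
    (h1 : inv_hmap m) (h2 : planar m) (h3 : ring m l) :
    (∀ i : ℕ, i < l.length → nc (Bl m (l.take i)) = nc m) ∧
    nc (Bl m l) = nc m + 1 := by
  induction l generalizing m with
  | nil => exact absurd rfl h3.1
  | cons q l ih =>
    obtain ⟨x, b⟩ := q
    have hs : succd m Dim.zero x := h3.2.1.2.2
    have K := brk h1 hs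
    cases l with
    | nil =>
      refine ⟨?_, K.ncT h2 h3.2.2.2.1⟩
      intro i hi
      have : i = 0 := by simpa using hi
      subst this
      rfl
    | cons p l =>
      obtain ⟨hne, hr⟩ := ring_step h1 h3
      have hn := K.ncF h2 hne
      obtain ⟨j1, j2⟩ := ih _ K.inv (K.pl h2) hr
      refine ⟨?_, ?_⟩
      · intro i hi
        cases i with
        | zero => rfl
        | succ i =>
          rw [List.take_succ_cons, Bl, ← hn]
          exact j1 i (by simpa using hi)
      · rw [Bl, ← hn]; exact j2
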